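/- Let d ≥ 1, m ∈ ℝ, 0 < q < ∞, and s > τ_q := d/min(1,q) − d. Let a ∈ S^m_{1,1}. Then there is a constant C, independent of μ and f, such that for every μ ∈ ℕ and every Schwartz function f on ℝ^d one has sup_{P∈D_μ} (|P|^{−1} ∫_P Σ_{k=μ}^∞ 2^{skq} |Π_k T_a f(x)|^q dx)^{1/q} ≤ C [ sup_{0≤k≤μ−1} 2^{k(s+m)} ‖Π_k f‖_{L^∞} + sup_{R∈D_μ} (|R|^{−1} ∫_R Σ_{k=μ}^∞ 2^{(s+m)kq} |Π_k f(x)|^q dx)^{1/q} ]. -/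

import Mathlib

noncomputable section

open MeasureTheory SchwartzMap Complex RealInnerProductSpace Filter
open scoped ENNReal NNReal ContDiff SchwartzMap

/-- Euclidean space `ℝ^d`. -/
abbrev RD (d : ℕ) : Type := EuclideanSpace ℝ (Fin d)

/-- Tempered distributions on `ℝ^d`. -/
abbrev TD (d : ℕ) : Type := 𝓢(RD d, ℂ) →L[ℂ] ℂ

/-- Fourier transform of a Schwartz function (with the convention
`f̂(ξ) = ∫ f(x) e^{-2πi⟨x,ξ⟩} dx`). -/
def fourierS {d : ℕ} (f : 𝓢(RD d, ℂ)) : 𝓢(RD d, ℂ) :=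
  SchwartzMap.fourierTransformCLM ℂ f

/-- Hörmander symbol class `S^m_{1,1}`: `a` is smooth and
`‖∂_ξ^α ∂_x^β a(x,ξ)‖ ≤ c_{α,β} (1+‖ξ‖)^{m-|α|+|β|}` for all orders of derivatives. -/
def IsSymbolS11 (d : ℕ) (m : ℝ) (a : RD d → RD d → ℂ) : Prop :=
  ContDiff ℝ ∞ (fun p : RD d × RD d => a p.1 p.2) ∧
  ∀ α β : ℕ, ∃ c : ℝ, ∀ x ξ : RD d,
    ‖iteratedFDeriv ℝ α (fun ξ' => iteratedFDeriv ℝ β (fun x' => a x' ξ') x) ξ‖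
      ≤ c * (1 + ‖ξ‖) ^ (m - (α : ℝ) + (β : ℝ))

/-- The pseudo-differential operator `T_a f(x) = ∫ a(x,ξ) f̂(ξ) e^{2πi⟨x,ξ⟩} dξ`
acting on a Schwartz function `f`. -/
def pdo {d : ℕ} (a : RD d → RD d → ℂ) (f : 𝓢(RD d, ℂ)) (x : RD d) : ℂ :=
  ∫ ξ, a x ξ * fourierS f ξ * Complex.exp (2 * Real.pi * Complex.I * ((⟪x, ξ⟫ : ℝ) : ℂ))

/-- Littlewood–Paley data: a Schwartz function `φ` with `φ̂` supported in
`{1/2 ≤ |ξ| ≤ 2}` and `Σ_{k∈ℤ} φ̂(2^{-k}ξ) = 1` for `ξ ≠ 0`, together with the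
low-frequency piece `Φ` determined by `Φ̂ = 1 - Σ_{k≥1} φ̂(2^{-k}·)`. -/
structure LPData (d : ℕ) where
  φ : 𝓢(RD d, ℂ)
  Φ : 𝓢(RD d, ℂ)
  supp_φ : ∀ ξ : RD d, fourierS φ ξ ≠ 0 → 1/2 ≤ ‖ξ‖ ∧ ‖ξ‖ ≤ 2
  sum_φ : ∀ ξ : RD d, ξ ≠ 0 → HasSum (fun k : ℤ => fourierS φ ((2:ℝ)^(-k) • ξ)) 1
  Φ_def : ∀ ξ : RD d, fourierS Φ ξ = 1 - ∑' k : ℕ, fourierS φ (((2:ℝ)^(k+1))⁻¹ • ξ)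

/-- The Littlewood–Paley convolution kernel: `Φ` for `k = 0` and
`φ_k = 2^{kd} φ(2^k ·)` for `k ≥ 1`. -/
def LPkernel {d : ℕ} (D : LPData d) : ℕ → RD d → ℂ
  | 0, x => D.Φ x
  | (k+1), x => (((2:ℝ)^((k+1) * d) : ℝ) : ℂ) * D.φ ((2:ℝ)^(k+1) • x)

/-- The Fourier transform of the `k`-th Littlewood–Paley kernel, i.e. `φ̂_k = φ̂(2^{-k}·)`
for `k ≥ 1` and `Φ̂` for `k = 0`. -/
def LPhat {d : ℕ} (D : LPData d) : ℕ → RD d → ℂ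
  | 0, ξ => fourierS D.Φ ξ
  | (k+1), ξ => fourierS D.φ (((2:ℝ)^(k+1))⁻¹ • ξ)

/-- Littlewood–Paley operator `Π_k g = φ_k ∗ g` (with `φ_0 := Φ`) acting on functions. -/
def LP {d : ℕ} (D : LPData d) (k : ℕ) (g : RD d → ℂ) (x : RD d) : ℂ :=
  ∫ y, LPkernel D k y * g (x - y)

/-- `Π*_k = Π_{k-1} + Π_k + Π_{k+1}` (with the convention `φ_{-1} := 0`). -/
def LPstar {d : ℕ} (D : LPData d) (k : ℕ) (g : RD d → ℂ) (x : RD d) : ℂ :=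
  (if k = 0 then 0 else LP D (k-1) g x) + LP D k g x + LP D (k+1) g x

open Classical in
/-- Pairing of a tempered distribution with a plain function: it gives `u ψ` if the
function is (the coercion of) a Schwartz function `ψ`, and `0` otherwise. -/
def pairing {d : ℕ} (u : TD d) (g : RD d → ℂ) : ℂ :=
  if h : ∃ ψ : 𝓢(RD d, ℂ), ⇑ψ = g then u h.choose else 0

/-- Fourier transform of a tempered distribution, `⟨û, ψ⟩ = ⟨u, ψ̂⟩`. -/
def fourierTD {d : ℕ} (u : TD d) : TD d :=
  u.comp (SchwartzMap.fourierTransformCLM ℂ)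

/-- Littlewood–Paley operator on tempered distributions:
`Π_k u (x) = ⟨u, φ_k(x - ·)⟩`. -/
def LPdist {d : ℕ} (D : LPData d) (k : ℕ) (u : TD d) (x : RD d) : ℂ :=
  pairing u (fun y => LPkernel D k (x - y))

/-- The symbol `a_{j,k}(x,ξ) = (φ_j ∗ a(·,ξ))(x) · φ̂_k(ξ)` (with `Φ` replacing `φ_0`). -/
def symbolPiece {d : ℕ} (D : LPData d) (a : RD d → RD d → ℂ) (j k : ℕ)
    (x ξ : RD d) : ℂ :=
  (∫ y, LPkernel D j y * a (x - y) ξ) * LPhat D k ξ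

/-- `T_{a_{j,k}} u (x) = ⟨û, a_{j,k}(x,·) e^{2πi⟨x,·⟩}⟩` for a tempered distribution `u`. -/
def pdoPieceD {d : ℕ} (D : LPData d) (a : RD d → RD d → ℂ) (j k : ℕ)
    (u : TD d) (x : RD d) : ℂ :=
  pairing (fourierTD u)
    (fun ξ => symbolPiece D a j k x ξ * Complex.exp (2 * Real.pi * Complex.I * ((⟪x, ξ⟫ : ℝ) : ℂ)))

/-- Partial sums `Σ_{j=0}^N Σ_{k=0}^N T_{a_{j,k}} u (x)`. -/
def pdoPartial {d : ℕ} (D : LPData d) (a : RD d → RD d → ℂ) (N : ℕ)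
    (u : TD d) (x : RD d) : ℂ :=
  ∑ j ∈ Finset.range (N+1), ∑ k ∈ Finset.range (N+1), pdoPieceD D a j k u x

/-- `T_a u` converges in `S'` to the tempered distribution `Tf`: the partial sums
`Σ_{j,k≤N} T_{a_{j,k}} u` (which are functions) converge to `Tf` weakly. -/
def ConvergesInSPrime {d : ℕ} (D : LPData d) (a : RD d → RD d → ℂ)
    (u : TD d) (Tf : TD d) : Prop :=
  ∀ ψ : 𝓢(RD d, ℂ),
    Tendsto (fun N => ∫ x, pdoPartial D a N u x * ψ x) atTop (nhds (Tf ψ))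

/-- The dyadic cube of level `ν` (side length `2^{-ν}`) indexed by `n ∈ ℤ^d`. -/
def dyadicCube (d : ℕ) (ν : ℤ) (n : Fin d → ℤ) : Set (RD d) :=
  {x | ∀ i, (n i : ℝ) * (2:ℝ)^(-ν) ≤ x i ∧ x i < ((n i : ℝ) + 1) * (2:ℝ)^(-ν)}

/-- The local quantity `(|P|⁻¹ ∫_P Σ_{k=k₀}^∞ 2^{skq} ‖g_k(x)‖^q dx)^{1/q}` for the
dyadic cube `P` of level `μ` indexed by `n` (so that `|P|⁻¹ = 2^{μd}`). -/
def cubePiece (d : ℕ) (μ : ℕ) (n : Fin d → ℤ) (k₀ : ℕ) (s q : ℝ)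
    (g : ℕ → RD d → ℂ) : ℝ≥0∞ :=
  ((2:ℝ≥0∞)^((μ:ℝ)*(d:ℝ)) *
    ∫⁻ x in dyadicCube d μ n,
      ∑' j : ℕ, (2:ℝ≥0∞)^(s*((k₀:ℝ)+(j:ℝ))*q) * (‖g (k₀+j) x‖₊ : ℝ≥0∞)^q) ^ (1/q)

/-- The `F_∞^{s,q}` norm (for `q < ∞`) of a function, computed from its
Littlewood–Paley pieces:
`‖Π_0 g‖_∞ + sup_{l(P)<1 dyadic} (|P|⁻¹ ∫_P Σ_{k=-log₂ l(P)}^∞ 2^{skq}|Π_k g|^q)^{1/q}`. -/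
def FinftyNormFun {d : ℕ} (D : LPData d) (s q : ℝ) (g : RD d → ℂ) : ℝ≥0∞ :=
  (⨆ x : RD d, (‖LP D 0 g x‖₊ : ℝ≥0∞)) +
  ⨆ (μ : ℕ) (_ : 1 ≤ μ) (n : Fin d → ℤ),
    cubePiece d μ n μ s q (fun k x => LP D k g x)

/-- The `F_∞^{s,q}` norm (for `q < ∞`) of a tempered distribution. -/
def FinftyNormDist {d : ℕ} (D : LPData d) (s q : ℝ) (u : TD d) : ℝ≥0∞ :=
  (⨆ x : RD d, (‖LPdist D 0 u x‖₊ : ℝ≥0∞)) +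
  ⨆ (μ : ℕ) (_ : 1 ≤ μ) (n : Fin d → ℤ),
    cubePiece d μ n μ s q (fun k x => LPdist D k u x)

/-- The (axis-parallel, closed) cube with corner `c` and side length `L`. -/
def cube (d : ℕ) (c : RD d) (L : ℝ) : Set (RD d) :=
  {x | ∀ i, c i ≤ x i ∧ x i ≤ c i + L}

/-- The average of `g` over the cube with corner `c` and side length `L`. -/
def cubeMean {d : ℕ} (c : RD d) (L : ℝ) (g : RD d → ℂ) : ℂ :=
  (L^d)⁻¹ • ∫ x in cube d c L, g x

/-- The `bmo` norm (local BMO):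
`sup_{l(Q)≥1} |Q|⁻¹∫_Q |g| + sup_{l(Q)<1} |Q|⁻¹∫_Q |g - g_Q|`, over all cubes `Q`. -/
def bmoNorm (d : ℕ) (g : RD d → ℂ) : ℝ≥0∞ :=
  (⨆ (c : RD d) (L : ℝ) (_ : 1 ≤ L),
    ENNReal.ofReal ((L^d)⁻¹) * ∫⁻ x in cube d c L, (‖g x‖₊ : ℝ≥0∞)) +
  (⨆ (c : RD d) (L : ℝ) (_ : 0 < L) (_ : L < 1),
    ENNReal.ofReal ((L^d)⁻¹) * ∫⁻ x in cube d c L, (‖g x - cubeMean c L g‖₊ : ℝ≥0∞))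

/-- The Peetre maximal function `𝔐_{σ,R} g(x) = sup_y ‖g(x-y)‖/(1+R‖y‖)^σ`. -/
def peetre {d : ℕ} (σ R : ℝ) (g : RD d → ℂ) (x : RD d) : ℝ≥0∞ :=
  ⨆ y : RD d, (‖g (x - y)‖₊ : ℝ≥0∞) / ENNReal.ofReal ((1 + R * ‖y‖) ^ σ)

/-- `g` has (distributional) Fourier support contained in `K`: the pairing
`⟨ĝ, ψ⟩ = ∫ g · ψ̂` vanishes for every Schwartz `ψ` whose support does not meet `K`. -/
def HasFourierSupportIn {d : ℕ} (g : RD d → ℂ) (K : Set (RD d)) : Prop :=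
  ∀ ψ : 𝓢(RD d, ℂ), tsupport ⇑ψ ∩ K = ∅ → ∫ x, g x * fourierS ψ x = 0

/-! ### Polynomially decaying weights and weighted averages -/

lemma two_rpow_add (a b : ℝ) : (2 : ℝ≥0∞) ^ (a + b) = (2 : ℝ≥0∞) ^ a * (2 : ℝ≥0∞) ^ b :=
  ENNReal.rpow_add _ _ two_ne_zero ENNReal.ofNat_ne_top

lemma two_rpow_ne_zero (a : ℝ) : (2 : ℝ≥0∞) ^ a ≠ 0 :=
  (ENNReal.rpow_pos two_pos ENNReal.ofNat_ne_top).ne'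

lemma two_rpow_ne_top (a : ℝ) : (2 : ℝ≥0∞) ^ a ≠ ⊤ :=
  ENNReal.rpow_ne_top_of_ne_zero two_ne_zero ENNReal.ofNat_ne_top

lemma two_rpow_le {a b : ℝ} (h : a ≤ b) : (2 : ℝ≥0∞) ^ a ≤ (2 : ℝ≥0∞) ^ b :=
  ENNReal.rpow_le_rpow_of_exponent_le one_le_two h

lemma ofReal_two_rpow (a : ℝ) : ENNReal.ofReal ((2 : ℝ) ^ a) = (2 : ℝ≥0∞) ^ a := by
  rw [← ENNReal.ofReal_rpow_of_pos two_pos, ENNReal.ofReal_ofNat]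

/-- The weight `(1 + 2^k ‖y‖)^{-N}`. -/
def wt {d : ℕ} (k : ℕ) (N : ℝ) (y : RD d) : ℝ≥0∞ :=
  ENNReal.ofReal (1 + 2 ^ k * ‖y‖) ^ (-N)

section weights

variable {d : ℕ}

lemma one_le_wt_base (k : ℕ) (y : RD d) : (1 : ℝ≥0∞) ≤ ENNReal.ofReal (1 + 2 ^ k * ‖y‖) := by
  rw [ENNReal.one_le_ofReal]
  have : 0 ≤ (2 : ℝ) ^ k * ‖y‖ := by positivity
  linarith

lemma wt_eq_ofReal (k : ℕ) (N : ℝ) (y : RD d) :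
    wt k N y = ENNReal.ofReal ((1 + 2 ^ k * ‖y‖) ^ (-N)) := by
  rw [wt, ENNReal.ofReal_rpow_of_pos (by positivity)]

lemma wt_ne_top (k : ℕ) (N : ℝ) (y : RD d) : wt k N y ≠ ⊤ := by
  rw [wt_eq_ofReal]; exact ENNReal.ofReal_ne_top

lemma wt_ne_zero (k : ℕ) (N : ℝ) (y : RD d) : wt k N y ≠ 0 := by
  rw [wt_eq_ofReal, Ne, ENNReal.ofReal_eq_zero, not_le]
  positivity

lemma wt_neg (k : ℕ) (N : ℝ) (y : RD d) : wt k N (-y) = wt k N y := by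
  simp [wt]

lemma wt_sub_comm (k : ℕ) (N : ℝ) (x y : RD d) : wt k N (x - y) = wt k N (y - x) := by
  rw [← wt_neg, neg_sub]

lemma wt_add (k : ℕ) (N M : ℝ) (y : RD d) : wt k (N + M) y = wt k N y * wt k M y := by
  rw [wt, wt, wt, neg_add, ENNReal.rpow_add _ _ _ ENNReal.ofReal_ne_top]
  exact (zero_lt_one.trans_le (one_le_wt_base k y)).ne'

lemma wt_rpow (k : ℕ) (N q : ℝ) (y : RD d) : wt k N y ^ q = wt k (N * q) y := by
  rw [wt, wt, ← ENNReal.rpow_mul, neg_mul]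

lemma wt_antitone_exponent (k : ℕ) {N M : ℝ} (h : N ≤ M) (y : RD d) : wt k M y ≤ wt k N y :=
  ENNReal.rpow_le_rpow_of_exponent_le (one_le_wt_base k y) (neg_le_neg h)

lemma wt_antitone_scale {j k : ℕ} (h : j ≤ k) {N : ℝ} (hN : 0 ≤ N) (y : RD d) :
    wt k N y ≤ wt j N y := by
  rw [wt, wt, ENNReal.rpow_neg, ENNReal.rpow_neg, ENNReal.inv_le_inv]
  gcongr
  norm_num

lemma wt_mul_wt_le (k : ℕ) {N : ℝ} (hN : 0 ≤ N) (x z y : RD d) :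
    wt k N (x - z) * wt k N (z - y) ≤ wt k N (x - y) := by
  rw [wt, wt, wt, ENNReal.rpow_neg, ENNReal.rpow_neg, ENNReal.rpow_neg,
    ← ENNReal.mul_inv (.inr (by simp [hN])) (.inl (by simp [hN])), ENNReal.inv_le_inv,
    ← ENNReal.mul_rpow_of_nonneg _ _ hN, ← ENNReal.ofReal_mul (by positivity)]
  gcongr
  have h1 : ‖x - y‖ ≤ ‖x - z‖ + ‖z - y‖ := norm_sub_le_norm_sub_add_norm_sub x z y
  have h2 : (2 : ℝ) ^ k * ‖x - y‖ ≤ 2 ^ k * (‖x - z‖ + ‖z - y‖) := by gcongr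
  have h3 : 0 ≤ ((2 : ℝ) ^ k * ‖x - z‖) * (2 ^ k * ‖z - y‖) := by positivity
  nlinarith

@[fun_prop]
lemma continuous_wt (k : ℕ) (N : ℝ) : Continuous (wt k N : RD d → ℝ≥0∞) := by
  have : (wt k N : RD d → ℝ≥0∞) = fun y => ENNReal.ofReal ((1 + 2 ^ k * ‖y‖) ^ (-N)) := by
    funext y; exact wt_eq_ofReal k N y
  rw [this]
  refine ENNReal.continuous_ofReal.comp (Continuous.rpow_const (by fun_prop) fun y => Or.inl ?_)
  positivity

@[fun_prop]
lemma measurable_wt (k : ℕ) (N : ℝ) : Measurable (wt k N : RD d → ℝ≥0∞) :=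
  (continuous_wt k N).measurable

/-- The total mass of the normalized weight. -/
def wtMass (d : ℕ) (N : ℝ) : ℝ≥0∞ := ∫⁻ y : RD d, wt 0 N y

lemma wtMass_ne_top {N : ℝ} (hN : (d : ℝ) < N) : wtMass d N ≠ ⊤ := by
  have := finite_integral_one_add_norm (E := RD d) (μ := volume) (r := N) (by simpa using hN)
  refine ne_of_lt ?_
  simpa [wtMass, wt_eq_ofReal] using this

lemma lintegral_scale (k : ℕ) {g : RD d → ℝ≥0∞} (hg : Measurable g) :
    ∫⁻ y, (2 : ℝ≥0∞) ^ ((k : ℝ) * d) * g ((2 : ℝ) ^ k • y) = ∫⁻ y, g y := by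
  have h2 : (2 : ℝ) ^ k ≠ 0 := by positivity
  have h := Measure.map_addHaar_smul (volume : Measure (RD d)) h2
  have h3 : ∫⁻ y, g ((2 : ℝ) ^ k • y) = ∫⁻ y, g y ∂(Measure.map ((2 : ℝ) ^ k • ·) volume) := by
    rw [lintegral_map hg (measurable_const_smul _)]
  rw [lintegral_const_mul' _ _ (two_rpow_ne_top _), h3, h, lintegral_smul_measure, smul_eq_mul,
    ← mul_assoc, ← ofReal_two_rpow, ← ENNReal.ofReal_mul (by positivity)]
  have : (2 : ℝ) ^ ((k : ℝ) * d) * |(((2 : ℝ) ^ k) ^ Module.finrank ℝ (RD d))⁻¹| = 1 := by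
    rw [abs_of_pos (by positivity), finrank_euclideanSpace_fin, ← pow_mul, ← Nat.cast_mul,
      Real.rpow_natCast]
    exact mul_inv_cancel₀ (by positivity)
  rw [this]; simp

lemma lintegral_wt (k : ℕ) (N : ℝ) :
    ∫⁻ y : RD d, (2 : ℝ≥0∞) ^ ((k : ℝ) * d) * wt k N y = wtMass d N := by
  rw [wtMass, ← lintegral_scale k (measurable_wt 0 N)]
  simp [wt, norm_smul]

lemma lintegral_wt_sub_left (k : ℕ) (N : ℝ) (x : RD d) :
    ∫⁻ y : RD d, (2 : ℝ≥0∞) ^ ((k : ℝ) * d) * wt k N (x - y) = wtMass d N := by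
  rw [lintegral_sub_left_eq_self (fun y => (2 : ℝ≥0∞) ^ ((k : ℝ) * d) * wt k N y) x,
    lintegral_wt]

lemma lintegral_wt_sub_right (k : ℕ) (N : ℝ) (x : RD d) :
    ∫⁻ y : RD d, (2 : ℝ≥0∞) ^ ((k : ℝ) * d) * wt k N (y - x) = wtMass d N := by
  simp_rw [wt_sub_comm k N _ x]
  exact lintegral_wt_sub_left k N x

/-- The weighted average of `h` at scale `2^{-j}` around `x`. -/
def wavg (j : ℕ) (N : ℝ) (h : RD d → ℝ≥0∞) (x : RD d) : ℝ≥0∞ :=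
  ∫⁻ y, (2 : ℝ≥0∞) ^ ((j : ℝ) * d) * wt j N (x - y) * h y

lemma wavg_const_mul (j : ℕ) (N : ℝ) {c : ℝ≥0∞} (hc : c ≠ ⊤) (h : RD d → ℝ≥0∞) (x : RD d) :
    wavg j N (fun y => c * h y) x = c * wavg j N h x := by
  rw [wavg, wavg, ← lintegral_const_mul' _ _ hc]
  exact lintegral_congr fun y => by ring

lemma wavg_le_of_le (j : ℕ) (N : ℝ) {h : RD d → ℝ≥0∞} {c : ℝ≥0∞} (hh : ∀ y, h y ≤ c)
    (x : RD d) : wavg j N h x ≤ wtMass d N * c := by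
  calc wavg j N h x ≤ ∫⁻ y, (2 : ℝ≥0∞) ^ ((j : ℝ) * d) * wt j N (x - y) * c :=
        lintegral_mono fun y => mul_le_mul_right (hh y) _
    _ = _ := by
        rw [lintegral_mul_const _ (by fun_prop), lintegral_wt_sub_left]

lemma wavg_antitone_exponent (j : ℕ) {N M : ℝ} (h : N ≤ M) (g : RD d → ℝ≥0∞) (x : RD d) :
    wavg j M g x ≤ wavg j N g x :=
  lintegral_mono fun y => by gcongr; exact wt_antitone_exponent j h _

@[fun_prop]
lemma measurable_wavg (j : ℕ) (N : ℝ) {h : RD d → ℝ≥0∞} (hh : Measurable h) :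
    Measurable (wavg j N h) := by
  unfold wavg
  apply Measurable.lintegral_prod_right'
    (f := fun p : RD d × RD d => (2 : ℝ≥0∞) ^ ((j : ℝ) * d) * wt j N (p.1 - p.2) * h p.2)
  have : Measurable fun p : RD d × RD d => p.1 - p.2 := by fun_prop
  fun_prop

lemma lintegral_wt_mul_wt_le (j k : ℕ) {N : ℝ} (hN : 0 ≤ N) (x y : RD d) :
    ∫⁻ z, ((2 : ℝ≥0∞) ^ ((j : ℝ) * d) * wt j (N + (d + 1)) (x - z)) *
      ((2 : ℝ≥0∞) ^ ((k : ℝ) * d) * wt k (N + (d + 1)) (z - y)) ≤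
    wtMass d (d + 1) * ((2 : ℝ≥0∞) ^ (((min j k : ℕ) : ℝ) * d) * wt (min j k) N (x - y)) := by
  have hd : (0 : ℝ) ≤ (d : ℝ) + 1 := by positivity
  have key : ∀ z : RD d, wt j N (x - z) * wt k N (z - y) ≤ wt (min j k) N (x - y) := fun z =>
    (mul_le_mul' (wt_antitone_scale (min_le_left j k) hN _)
      (wt_antitone_scale (min_le_right j k) hN _)).trans (wt_mul_wt_le _ hN x z y)
  rcases le_total j k with hjk | hjk
  · rw [min_eq_left hjk] at key ⊢
    calc _ ≤ ∫⁻ z, ((2 : ℝ≥0∞) ^ ((k : ℝ) * d) * wt k (d + 1) (z - y)) *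
          ((2 : ℝ≥0∞) ^ ((j : ℝ) * d) * wt j N (x - y)) := by
          refine lintegral_mono fun z => ?_
          calc _ ≤ ((2 : ℝ≥0∞) ^ ((j : ℝ) * d) * wt j N (x - z)) *
              ((2 : ℝ≥0∞) ^ ((k : ℝ) * d) * (wt k N (z - y) * wt k (d + 1) (z - y))) := by
                rw [← wt_add]
                gcongr
                exact wt_antitone_exponent j (by linarith) _
            _ = ((2 : ℝ≥0∞) ^ ((k : ℝ) * d) * wt k (d + 1) (z - y)) *
                ((2 : ℝ≥0∞) ^ ((j : ℝ) * d) * (wt j N (x - z) * wt k N (z - y))) := by ring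
            _ ≤ _ := by gcongr; exact key z
      _ = _ := by
          rw [lintegral_mul_const _ (by fun_prop), lintegral_wt_sub_right]
  · rw [min_eq_right hjk] at key ⊢
    calc _ ≤ ∫⁻ z, ((2 : ℝ≥0∞) ^ ((j : ℝ) * d) * wt j (d + 1) (x - z)) *
          ((2 : ℝ≥0∞) ^ ((k : ℝ) * d) * wt k N (x - y)) := by
          refine lintegral_mono fun z => ?_
          calc _ ≤ ((2 : ℝ≥0∞) ^ ((j : ℝ) * d) * (wt j N (x - z) * wt j (d + 1) (x - z))) *
              ((2 : ℝ≥0∞) ^ ((k : ℝ) * d) * wt k N (z - y)) := by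
                rw [← wt_add]
                gcongr
                exact wt_antitone_exponent k (by linarith) _
            _ = ((2 : ℝ≥0∞) ^ ((j : ℝ) * d) * wt j (d + 1) (x - z)) *
                ((2 : ℝ≥0∞) ^ ((k : ℝ) * d) * (wt j N (x - z) * wt k N (z - y))) := by ring
            _ ≤ _ := by gcongr; exact key z
      _ = _ := by
          rw [lintegral_mul_const _ (by fun_prop), lintegral_wt_sub_left]

/-- Iterated weighted averages are controlled by one at the coarser scale. -/
lemma wavg_wavg_le (j k : ℕ) {N : ℝ} (hN : 0 ≤ N) {h : RD d → ℝ≥0∞} (hh : Measurable h)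
    (x : RD d) :
    wavg j (N + (d + 1)) (wavg k (N + (d + 1)) h) x ≤
      wtMass d (d + 1) * wavg (min j k) N h x := by
  have hm : Measurable fun p : RD d × RD d => p.1 - p.2 := by fun_prop
  calc wavg j (N + (d + 1)) (wavg k (N + (d + 1)) h) x
      = ∫⁻ z, ∫⁻ y, ((2 : ℝ≥0∞) ^ ((j : ℝ) * d) * wt j (N + (d + 1)) (x - z)) *
          ((2 : ℝ≥0∞) ^ ((k : ℝ) * d) * wt k (N + (d + 1)) (z - y) * h y) := by
        refine lintegral_congr fun z => ?_
        rw [lintegral_const_mul _ (by fun_prop), wavg]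
    _ = ∫⁻ y, ∫⁻ z, ((2 : ℝ≥0∞) ^ ((j : ℝ) * d) * wt j (N + (d + 1)) (x - z)) *
          ((2 : ℝ≥0∞) ^ ((k : ℝ) * d) * wt k (N + (d + 1)) (z - y) * h y) := by
        rw [lintegral_lintegral_swap]
        refine Measurable.aemeasurable ?_
        simp only [Function.uncurry_def]
        fun_prop
    _ ≤ ∫⁻ y, wtMass d (d + 1) *
          ((2 : ℝ≥0∞) ^ (((min j k : ℕ) : ℝ) * d) * wt (min j k) N (x - y)) * h y := by
        refine lintegral_mono fun y => ?_
        simp_rw [← mul_assoc _ _ (h y)]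
        rw [lintegral_mul_const _ (by fun_prop)]
        gcongr
        simpa only [mul_assoc] using lintegral_wt_mul_wt_le j k hN x y
    _ = _ := by
        simp_rw [mul_assoc (wtMass d (d + 1))]
        rw [lintegral_const_mul' _ _ (wtMass_ne_top (by simp)), wavg]

/-- Jensen's inequality for weighted averages. -/
lemma wavg_rpow_le_of_one_le (j : ℕ) (N : ℝ) {q : ℝ} (hq : 1 ≤ q) {h : RD d → ℝ≥0∞}
    (hh : Measurable h) (x : RD d) :
    wavg j N h x ^ q ≤ wtMass d N ^ (q - 1) * wavg j N (fun y => h y ^ q) x := by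
  rcases hq.eq_or_lt with rfl | hq
  · simp
  have hc : q.HolderConjugate (q / (q - 1)) := Real.HolderConjugate.conjExponent hq
  set g : RD d → ℝ≥0∞ := fun y => (2 : ℝ≥0∞) ^ ((j : ℝ) * d) * wt j N (x - y) with hg
  have hgm : Measurable g := by fun_prop
  have h0 := ENNReal.lintegral_mul_le_Lp_mul_Lq (volume : Measure (RD d)) hc
    (f := fun y => g y ^ (1 / q) * h y) (g := fun y => g y ^ (1 - 1 / q))
    (by fun_prop) (by fun_prop)
  have hq0 : q ≠ 0 := by positivity
  have hq1 : q - 1 ≠ 0 := by linarith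
  have e1 : ∀ y, ((fun y => g y ^ (1 / q) * h y) * fun y => g y ^ (1 - 1 / q)) y
      = g y * h y := by
    intro y
    have hg0 : g y ≠ 0 := mul_ne_zero (two_rpow_ne_zero _) (wt_ne_zero _ _ _)
    have hgt : g y ≠ ⊤ := ENNReal.mul_ne_top (two_rpow_ne_top _) (wt_ne_top _ _ _)
    simp only [Pi.mul_apply]
    rw [mul_right_comm, ← ENNReal.rpow_add _ _ hg0 hgt]
    simp
  have e2 : ∀ y, (g y ^ (1 / q) * h y) ^ q = g y * h y ^ q := by
    intro y
    rw [ENNReal.mul_rpow_of_nonneg _ _ (by positivity), ← ENNReal.rpow_mul]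
    simp [hq0]
  have e3 : ∀ y, (g y ^ (1 - 1 / q)) ^ (q / (q - 1)) = g y := by
    intro y
    rw [← ENNReal.rpow_mul]
    have : (1 - 1 / q) * (q / (q - 1)) = 1 := by field_simp
    rw [this, ENNReal.rpow_one]
  simp_rw [e1, e2, e3] at h0
  rw [lintegral_wt_sub_left] at h0
  calc wavg j N h x ^ q ≤ ((∫⁻ y, g y * h y ^ q) ^ (1 / q) *
        wtMass d N ^ (1 / (q / (q - 1)))) ^ q := ENNReal.rpow_le_rpow h0 (by positivity)
    _ = _ := by
        rw [ENNReal.mul_rpow_of_nonneg _ _ (by positivity), ← ENNReal.rpow_mul,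
          ← ENNReal.rpow_mul, mul_comm]
        congr 2
        · field_simp
        · rw [one_div_mul_cancel hq0, ENNReal.rpow_one]; rfl

/-- For `q < 1`, a function dominated by its own averages at the fine scale `2^{-k}` satisfies a
reverse Hölder inequality for averages at the coarse scale `2^{-j}`. -/
lemma wavg_rpow_le_of_lt_one {j k : ℕ} (hjk : j ≤ k) {N : ℝ} (hN : 0 ≤ N) {q : ℝ} (hq : 0 < q)
    (hq1 : q < 1) {h : RD d → ℝ≥0∞} (hh : Measurable h) {c : ℝ≥0∞}
    (hc : ∀ z, h z ≤ c * wavg k N h z) (x : RD d) (hfin : wavg j N h x ≠ ⊤) :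
    wavg j N h x ^ q ≤ c ^ (1 - q) * (2 : ℝ≥0∞) ^ (((k : ℝ) - j) * d * (1 - q)) *
      wavg j (N * q) (fun y => h y ^ q) x := by
  set I := wavg j N h x with hI
  rcases eq_or_ne I 0 with h0 | h0
  · rw [h0, ENNReal.zero_rpow_of_pos hq]; exact zero_le
  have hH : ∀ z, wt j N (x - z) * h z ≤ c * (2 : ℝ≥0∞) ^ (((k : ℝ) - j) * d) * I := by
    intro z
    calc wt j N (x - z) * h z
        ≤ wt j N (x - z) * (c * wavg k N h z) := by gcongr; exact hc z
      _ = c * ∫⁻ y, wt j N (x - z) *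
          ((2 : ℝ≥0∞) ^ ((k : ℝ) * d) * wt k N (z - y) * h y) := by
          rw [lintegral_const_mul' _ _ (wt_ne_top _ _ _), wavg]; ring
      _ ≤ c * ∫⁻ y, (2 : ℝ≥0∞) ^ (((k : ℝ) - j) * d) *
          ((2 : ℝ≥0∞) ^ ((j : ℝ) * d) * wt j N (x - y) * h y) := by
          refine mul_le_mul_right (lintegral_mono fun y => ?_) _
          calc _ = (2 : ℝ≥0∞) ^ ((k : ℝ) * d) * (wt j N (x - z) * wt k N (z - y)) * h y := by ring
            _ ≤ (2 : ℝ≥0∞) ^ ((k : ℝ) * d) * (wt j N (x - y)) * h y := by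
              gcongr
              exact (mul_le_mul_right (wt_antitone_scale hjk hN _) _).trans
                (wt_mul_wt_le _ hN x z y)
            _ = _ := by
              rw [← mul_assoc, ← mul_assoc, ← two_rpow_add]
              congr 4; ring
      _ = _ := by rw [lintegral_const_mul' _ _ (two_rpow_ne_top _), hI, wavg]; ring
  have hI2 : I ≤ (c * (2 : ℝ≥0∞) ^ (((k : ℝ) - j) * d) * I) ^ (1 - q) *
      wavg j (N * q) (fun y => h y ^ q) x := by
    have hfac : ∀ y, wt j N (x - y) * h y ≤
        (c * (2 : ℝ≥0∞) ^ (((k : ℝ) - j) * d) * I) ^ (1 - q) *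
          (wt j (N * q) (x - y) * h y ^ q) := by
      intro y
      rw [← wt_rpow, ← ENNReal.mul_rpow_of_nonneg _ _ hq.le]
      calc wt j N (x - y) * h y
          = (wt j N (x - y) * h y) ^ (1 - q) * (wt j N (x - y) * h y) ^ q := by
            rw [← ENNReal.rpow_add_of_nonneg _ _ (by linarith) hq.le]; simp
        _ ≤ _ := mul_le_mul_left (ENNReal.rpow_le_rpow (hH y) (by linarith)) _
    conv_lhs => rw [hI, wavg]
    conv_rhs => rw [wavg]
    refine (lintegral_mono fun y => ?_).trans (lintegral_const_mul _ (by fun_prop)).le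
    rw [mul_assoc]
    refine (mul_le_mul_right (hfac y) _).trans (le_of_eq ?_)
    ring
  have hIq : I ^ q = I * (I ^ (1 - q))⁻¹ := by
    rw [← ENNReal.rpow_neg]
    conv_rhs => enter [1]; rw [← ENNReal.rpow_one I]
    rw [← ENNReal.rpow_add _ _ h0 hfin]
    congr 1; ring
  rw [hIq]
  have h1 : I ^ (1 - q) ≠ 0 := by
    simp [ENNReal.rpow_eq_zero_iff, h0, hq1.le]
  have h2 : I ^ (1 - q) ≠ ⊤ := ENNReal.rpow_ne_top_of_nonneg (by linarith) hfin
  rw [← div_eq_mul_inv]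
  refine ENNReal.div_le_of_le_mul ?_
  refine hI2.trans (le_of_eq ?_)
  rw [ENNReal.mul_rpow_of_nonneg _ _ (by linarith), ENNReal.mul_rpow_of_nonneg _ _ (by linarith),
    ← ENNReal.rpow_mul]
  ring

/-- Averages of functions dominated by their own averages, raised to a power `q > 0`. -/
lemma wavg_rpow_le {N q : ℝ} (hN : (d : ℝ) < N) (hq : 0 < q) {c : ℝ≥0∞} (hc : c ≠ ⊤) :
    ∃ C : ℝ≥0∞, C ≠ ⊤ ∧ ∀ {j k : ℕ}, j ≤ k → ∀ {h : RD d → ℝ≥0∞}, Measurable h →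
      (∀ z, h z ≤ c * wavg k N h z) → ∀ x, wavg j N h x ≠ ⊤ →
      wavg j N h x ^ q ≤ C * (2 : ℝ≥0∞) ^ (((k : ℝ) - j) * d * (1 - min 1 q)) *
        wavg j (N * min 1 q) (fun y => h y ^ q) x := by
  rcases le_or_gt 1 q with h1 | h1
  · refine ⟨wtMass d N ^ (q - 1), ENNReal.rpow_ne_top_of_nonneg (by linarith) (wtMass_ne_top hN),
      fun _ _ hh _ x _ => ?_⟩
    simpa [min_eq_left h1] using wavg_rpow_le_of_one_le _ N h1 hh x
  · refine ⟨c ^ (1 - q), ENNReal.rpow_ne_top_of_nonneg (by linarith) hc,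
      fun hjk _ hh hdom x hfin => ?_⟩
    rw [min_eq_right h1.le]
    exact wavg_rpow_le_of_lt_one hjk ((Nat.cast_nonneg d).trans hN.le) hq h1 hh hdom x hfin

end weights

/-! ### Dyadic cubes -/

section cubes

variable {d : ℕ}

lemma dyadicCube_eq_preimage (μ : ℕ) (n : Fin d → ℤ) :
    dyadicCube d μ n = (MeasurableEquiv.toLp 2 (Fin d → ℝ)).symm ⁻¹'
      (Set.univ.pi fun i => Set.Ico ((n i : ℝ) * (2 : ℝ) ^ (-(μ : ℤ)))
        (((n i : ℝ) + 1) * (2 : ℝ) ^ (-(μ : ℤ)))) := by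
  ext x
  simp [dyadicCube, Set.mem_pi]

lemma measurableSet_dyadicCube (μ : ℕ) (n : Fin d → ℤ) : MeasurableSet (dyadicCube d μ n) := by
  rw [dyadicCube_eq_preimage]
  exact (MeasurableEquiv.measurable _) (MeasurableSet.univ_pi fun i => measurableSet_Ico)

lemma volume_dyadicCube (μ : ℕ) (n : Fin d → ℤ) :
    volume (dyadicCube d μ n) = (2 : ℝ≥0∞) ^ (-((μ : ℝ) * d)) := by
  rw [dyadicCube_eq_preimage,
    (EuclideanSpace.volume_preserving_symm_measurableEquiv_toLp (Fin d)).measure_preimage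
      (MeasurableSet.univ_pi fun i => measurableSet_Ico).nullMeasurableSet,
    volume_pi_pi]
  have : ∀ i : Fin d, volume (Set.Ico ((n i : ℝ) * (2 : ℝ) ^ (-(μ : ℤ)))
      (((n i : ℝ) + 1) * (2 : ℝ) ^ (-(μ : ℤ)))) = (2 : ℝ≥0∞) ^ (-(μ : ℝ)) := by
    intro i
    rw [Real.volume_Ico, ← ofReal_two_rpow]
    congr 1
    rw [← Real.rpow_intCast]
    push_cast
    ring
  simp_rw [this]
  rw [Finset.prod_const, Finset.card_univ, Fintype.card_fin, ← ENNReal.rpow_mul_natCast, neg_mul]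

lemma pairwise_disjoint_dyadicCube (μ : ℕ) :
    Pairwise (Function.onFun Disjoint fun n : Fin d → ℤ => dyadicCube d μ n) := by
  intro n n' hne
  rw [Function.onFun, Set.disjoint_left]
  intro x hx hx'
  refine hne (funext fun i => ?_)
  have h2 : (0 : ℝ) < (2 : ℝ) ^ (-(μ : ℤ)) := by positivity
  have h3 := lt_of_mul_lt_mul_right ((hx i).1.trans_lt (hx' i).2) h2.le
  have h4 := lt_of_mul_lt_mul_right ((hx' i).1.trans_lt (hx i).2) h2.le
  norm_cast at h3 h4
  omega

lemma iUnion_dyadicCube (μ : ℕ) : ⋃ n : Fin d → ℤ, dyadicCube d μ n = Set.univ := by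
  refine Set.eq_univ_of_forall fun x => Set.mem_iUnion.2 ⟨fun i => ⌊x i * 2 ^ μ⌋, fun i => ?_⟩
  have h2 : (0 : ℝ) < (2 : ℝ) ^ μ := by positivity
  rw [zpow_neg, zpow_natCast]
  constructor
  · rw [← div_eq_mul_inv, div_le_iff₀ h2]
    exact Int.floor_le _
  · rw [← div_eq_mul_inv, lt_div_iff₀ h2]
    exact Int.lt_floor_add_one _

lemma norm_sub_le_of_mem_dyadicCube {μ : ℕ} {n : Fin d → ℤ} {x y : RD d}
    (hx : x ∈ dyadicCube d μ n) (hy : y ∈ dyadicCube d μ n) : 2 ^ μ * ‖x - y‖ ≤ d := by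
  have h2 : (0 : ℝ) < (2 : ℝ) ^ μ := by positivity
  have hi : ∀ i, ‖(x - y) i‖ ≤ (2 ^ μ)⁻¹ := by
    intro i
    have h3 := hx i
    have h4 := hy i
    rw [zpow_neg, zpow_natCast] at h3 h4
    rw [PiLp.sub_apply, Real.norm_eq_abs, abs_le]
    constructor <;> linarith [h3.1, h3.2, h4.1, h4.2]
  have hn : ‖x - y‖ ≤ d * (2 ^ μ)⁻¹ := by
    rw [EuclideanSpace.norm_eq]
    refine Real.sqrt_le_iff.2 ⟨by positivity, ?_⟩
    calc ∑ i, ‖(x - y) i‖ ^ 2 ≤ ∑ _i : Fin d, ((2 : ℝ) ^ μ)⁻¹ ^ 2 :=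
          Finset.sum_le_sum fun i _ => by gcongr; exact hi i
      _ = d * ((2 : ℝ) ^ μ)⁻¹ ^ 2 := by simp
      _ ≤ (d : ℝ) ^ 2 * ((2 : ℝ) ^ μ)⁻¹ ^ 2 := by
          gcongr
          exact_mod_cast Nat.le_self_pow two_ne_zero d
      _ = _ := by ring
  calc 2 ^ μ * ‖x - y‖ ≤ 2 ^ μ * (d * (2 ^ μ)⁻¹) := by gcongr
    _ = d := by field_simp

/-- Weights are essentially constant on dyadic cubes of the same scale. -/
lemma wt_le_of_mem_dyadicCube {μ : ℕ} {n : Fin d → ℤ} {L : ℝ} (hL : 0 ≤ L) {x y : RD d}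
    (hx : x ∈ dyadicCube d μ n) (hy : y ∈ dyadicCube d μ n) (z : RD d) :
    wt μ L (z - x) ≤ ENNReal.ofReal (1 + d) ^ L * wt μ L (z - y) := by
  have h1 := wt_mul_wt_le μ hL z x y
  have h2 : (ENNReal.ofReal (1 + d) ^ L)⁻¹ ≤ wt μ L (x - y) := by
    rw [wt, ENNReal.rpow_neg, ENNReal.inv_le_inv]
    gcongr
    exact norm_sub_le_of_mem_dyadicCube hx hy
  have h3 : ENNReal.ofReal (1 + d) ^ L ≠ 0 := by
    refine (ENNReal.rpow_pos ?_ ENNReal.ofReal_ne_top).ne'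
    rw [ENNReal.ofReal_pos]; positivity
  have h4 : ENNReal.ofReal (1 + d) ^ L ≠ ⊤ :=
    ENNReal.rpow_ne_top_of_nonneg hL ENNReal.ofReal_ne_top
  calc wt μ L (z - x) = ENNReal.ofReal (1 + d) ^ L *
        (wt μ L (z - x) * (ENNReal.ofReal (1 + d) ^ L)⁻¹) := by
        rw [mul_comm (wt μ L (z - x)), ← mul_assoc, ENNReal.mul_inv_cancel h3 h4, one_mul]
    _ ≤ _ := by
        gcongr
        exact (mul_le_mul_right h2 _).trans h1

/-- A weighted integral at the scale of the cubes is controlled by the largest integral over a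
cube. -/
lemma lintegral_wt_mul_le_iSup (μ : ℕ) {L : ℝ} (hdL : (d : ℝ) < L) (h : RD d → ℝ≥0∞) (z : RD d) :
    ∫⁻ y, wt μ L (z - y) * h y ≤ ENNReal.ofReal (1 + d) ^ L * wtMass d L *
      ⨆ n : Fin d → ℤ, ∫⁻ y in dyadicCube d μ n, h y := by
  have hL : 0 ≤ L := (Nat.cast_nonneg d).trans hdL.le
  set S := ⨆ n : Fin d → ℤ, ∫⁻ y in dyadicCube d μ n, h y with hS
  set K := ENNReal.ofReal (1 + d) ^ L with hK
  have hcube : ∀ n : Fin d → ℤ, ∫⁻ y in dyadicCube d μ n, wt μ L (z - y) * h y ≤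
      (∫⁻ y in dyadicCube d μ n, K * ((2 : ℝ≥0∞) ^ ((μ : ℝ) * d) * wt μ L (z - y))) * S := by
    intro n
    set J := ∫⁻ y in dyadicCube d μ n, K * ((2 : ℝ≥0∞) ^ ((μ : ℝ) * d) * wt μ L (z - y)) with hJ
    have hpt : ∀ x ∈ dyadicCube d μ n, wt μ L (z - x) ≤ J := by
      intro x hx
      calc wt μ L (z - x) = ∫⁻ _ in dyadicCube d μ n,
            (2 : ℝ≥0∞) ^ ((μ : ℝ) * d) * wt μ L (z - x) := by
            rw [setLIntegral_const, volume_dyadicCube, mul_right_comm, ← two_rpow_add]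
            simp
        _ ≤ J := by
            refine setLIntegral_mono (by fun_prop) fun y hy => ?_
            rw [mul_left_comm]
            gcongr
            exact wt_le_of_mem_dyadicCube hL hx hy z
    calc ∫⁻ y in dyadicCube d μ n, wt μ L (z - y) * h y
        ≤ ∫⁻ y in dyadicCube d μ n, J * h y := by
          refine setLIntegral_mono' (measurableSet_dyadicCube μ n) fun y hy => ?_
          gcongr
          exact hpt y hy
      _ ≤ J * ∫⁻ y in dyadicCube d μ n, h y := by
          refine (lintegral_const_mul' _ _ (ne_top_of_le_ne_top ?_
            (setLIntegral_le_lintegral _ _))).le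
          rw [lintegral_const_mul _ (by fun_prop), lintegral_wt_sub_left]
          exact ENNReal.mul_ne_top (ENNReal.rpow_ne_top_of_nonneg hL ENNReal.ofReal_ne_top)
            (wtMass_ne_top hdL)
      _ ≤ J * S := by
          gcongr
          exact le_iSup (fun n : Fin d → ℤ => ∫⁻ y in dyadicCube d μ n, h y) n
  calc ∫⁻ y, wt μ L (z - y) * h y
      = ∫⁻ y in ⋃ n : Fin d → ℤ, dyadicCube d μ n, wt μ L (z - y) * h y := by
        rw [iUnion_dyadicCube, setLIntegral_univ]
    _ ≤ ∑' n : Fin d → ℤ, ∫⁻ y in dyadicCube d μ n, wt μ L (z - y) * h y :=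
        lintegral_iUnion_le _ _
    _ ≤ ∑' n : Fin d → ℤ, (∫⁻ y in dyadicCube d μ n,
          K * ((2 : ℝ≥0∞) ^ ((μ : ℝ) * d) * wt μ L (z - y))) * S := ENNReal.tsum_le_tsum hcube
    _ = _ := by
        rw [ENNReal.tsum_mul_right, ← lintegral_iUnion (measurableSet_dyadicCube μ)
          (pairwise_disjoint_dyadicCube μ), iUnion_dyadicCube, setLIntegral_univ,
          lintegral_const_mul _ (by fun_prop), lintegral_wt_sub_left]

/-- Integrating a fine-scale average over a cube. -/
lemma setLIntegral_wavg_le {μ i : ℕ} (hi : μ ≤ i) {L : ℝ} (hL : 0 ≤ L) (n : Fin d → ℤ)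
    {h : RD d → ℝ≥0∞} (hh : Measurable h) {z : RD d} (hz : z ∈ dyadicCube d μ n) :
    ∫⁻ x in dyadicCube d μ n, wavg i (L + L) h x ≤
      ENNReal.ofReal (1 + d) ^ L * wtMass d L * ∫⁻ y, wt μ L (z - y) * h y := by
  have hm : Measurable fun p : RD d × RD d => p.1 - p.2 := by fun_prop
  unfold wavg
  rw [lintegral_lintegral_swap (by
    refine Measurable.aemeasurable ?_
    simp only [Function.uncurry_def]
    fun_prop), ← lintegral_const_mul _ (by fun_prop)]
  refine lintegral_mono fun y => ?_
  simp only
  rw [lintegral_mul_const _ (by fun_prop), ← mul_assoc]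
  gcongr
  calc ∫⁻ x in dyadicCube d μ n, (2 : ℝ≥0∞) ^ ((i : ℝ) * d) * wt i (L + L) (x - y)
      ≤ ∫⁻ x in dyadicCube d μ n, ((2 : ℝ≥0∞) ^ ((i : ℝ) * d) * wt i L (x - y)) *
          (ENNReal.ofReal (1 + d) ^ L * wt μ L (z - y)) := by
        refine setLIntegral_mono (by fun_prop) fun x hx => ?_
        rw [wt_add, ← mul_assoc]
        gcongr
        refine (wt_antitone_scale hi hL _).trans ?_
        rw [wt_sub_comm, wt_sub_comm μ L z]
        exact wt_le_of_mem_dyadicCube hL hx hz y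
    _ ≤ ∫⁻ x, ((2 : ℝ≥0∞) ^ ((i : ℝ) * d) * wt i L (x - y)) *
          (ENNReal.ofReal (1 + d) ^ L * wt μ L (z - y)) := setLIntegral_le_lintegral _ _
    _ = _ := by
        rw [lintegral_mul_const _ (by fun_prop), lintegral_wt_sub_right]
        ring

end cubes

/-! ### Littlewood–Paley pieces of a Schwartz function -/

section pieces

open FourierTransform

variable {d : ℕ}

lemma fourierS_apply (f : 𝓢(RD d, ℂ)) (ξ : RD d) :
    fourierS f ξ = ∫ y, Complex.exp (((-2 * Real.pi * ⟪y, ξ⟫ : ℝ) : ℂ) * Complex.I) * f y := by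
  have : fourierS f ξ = 𝓕 (f : RD d → ℂ) ξ := rfl
  rw [this, Real.fourier_eq']
  rfl

/-- The `L¹`-normalized dilation `2^{kd} ψ(2^k ·)` of a Schwartz function. -/
def dilateS (k : ℕ) (ψ : 𝓢(RD d, ℂ)) : 𝓢(RD d, ℂ) :=
  (((2 : ℝ) ^ (k * d) : ℝ) : ℂ) • SchwartzMap.compCLMOfContinuousLinearEquiv ℂ
    (ContinuousLinearEquiv.smulLeft (R₁ := ℝ) (M₁ := RD d)
      (Units.mk0 ((2 : ℝ) ^ k) (by positivity))) ψ

lemma dilateS_apply (k : ℕ) (ψ : 𝓢(RD d, ℂ)) (x : RD d) :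
    dilateS k ψ x = (((2 : ℝ) ^ (k * d) : ℝ) : ℂ) * ψ ((2 : ℝ) ^ k • x) := rfl

lemma integral_dilate (k : ℕ) (g : RD d → ℂ) :
    ∫ y, (((2 : ℝ) ^ (k * d) : ℝ) : ℂ) * g ((2 : ℝ) ^ k • y) = ∫ y, g y := by
  rw [integral_const_mul, Measure.integral_comp_smul_of_nonneg volume _ _ (hR := by positivity)]
  rw [Complex.real_smul, ← mul_assoc, ← Complex.ofReal_mul, finrank_euclideanSpace_fin, pow_mul,
    mul_inv_cancel₀ (by positivity)]
  simp

lemma fourierS_dilateS (k : ℕ) (ψ : 𝓢(RD d, ℂ)) (ξ : RD d) :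
    fourierS (dilateS k ψ) ξ = fourierS ψ (((2 : ℝ) ^ k)⁻¹ • ξ) := by
  rw [fourierS_apply, fourierS_apply ψ, ← integral_dilate k fun y => Complex.exp
    (((-2 * Real.pi * ⟪y, ((2 : ℝ) ^ k)⁻¹ • ξ⟫ : ℝ) : ℂ) * Complex.I) * ψ y]
  refine integral_congr_ae (ae_of_all _ fun y => ?_)
  simp only
  rw [dilateS_apply, real_inner_smul_left, real_inner_smul_right, mul_left_comm,
    mul_inv_cancel_left₀ (by positivity)]

/-- The Littlewood–Paley kernels as Schwartz functions. -/
def LPkernelS (D : LPData d) : ℕ → 𝓢(RD d, ℂ)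
  | 0 => D.Φ
  | k + 1 => dilateS (k + 1) D.φ

lemma LPkernelS_apply (D : LPData d) (k : ℕ) (x : RD d) : LPkernelS D k x = LPkernel D k x := by
  cases k <;> rfl

lemma fourierS_LPkernelS (D : LPData d) (k : ℕ) (ξ : RD d) :
    fourierS (LPkernelS D k) ξ = LPhat D k ξ := by
  cases k with
  | zero => rfl
  | succ k => exact fourierS_dilateS _ _ _

/-- The Littlewood–Paley piece `Π_k f` as a Schwartz function. -/
def pieceS (D : LPData d) (k : ℕ) (f : 𝓢(RD d, ℂ)) : 𝓢(RD d, ℂ) :=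
  SchwartzMap.convolution (ContinuousLinearMap.mul ℂ ℂ) (LPkernelS D k) f

lemma pieceS_apply (D : LPData d) (k : ℕ) (f : 𝓢(RD d, ℂ)) (x : RD d) :
    pieceS D k f x = LP D k f x := by
  rw [pieceS, SchwartzMap.convolution_apply, MeasureTheory.convolution, LP]
  simp [LPkernelS_apply]

lemma fourierS_pieceS (D : LPData d) (k : ℕ) (f : 𝓢(RD d, ℂ)) (ξ : RD d) :
    fourierS (pieceS D k f) ξ = LPhat D k ξ * fourierS f ξ := by
  have h : fourierS (pieceS D k f) = 𝓕 (pieceS D k f) := rfl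
  rw [h, pieceS, SchwartzMap.fourier_convolution, ← fourierS_LPkernelS]
  rfl

lemma LPhat_succ_support (D : LPData d) (k : ℕ) {ξ : RD d} (h : LPhat D (k + 1) ξ ≠ 0) :
    (2 : ℝ) ^ (k + 1) / 2 ≤ ‖ξ‖ ∧ ‖ξ‖ ≤ 2 * 2 ^ (k + 1) := by
  have := D.supp_φ _ h
  rw [norm_smul, norm_inv, norm_pow, Real.norm_ofNat, inv_mul_eq_div] at this
  have h2 : (0 : ℝ) < 2 ^ (k + 1) := by positivity
  rw [div_le_iff₀ h2, le_div_iff₀ h2] at this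
  constructor <;> linarith [this.1, this.2]

/-- The rescaled sum of the high-frequency pieces is the tail of the homogeneous partition. -/
lemma hasSum_LPhat_succ (D : LPData d) (ξ : RD d) :
    HasSum (fun k => LPhat D (k + 1) ξ) (1 - LPhat D 0 ξ) := by
  have h : HasSum (fun k => LPhat D (k + 1) ξ) (∑' k : ℕ, LPhat D (k + 1) ξ) := by
    refine (summable_of_hasFiniteSupport ?_).hasSum
    obtain ⟨K, hK⟩ := pow_unbounded_of_one_lt (2 * ‖ξ‖) (one_lt_two (α := ℝ))
    refine (Set.finite_lt_nat K).subset fun k hk => ?_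
    have h1 := (LPhat_succ_support D k hk).1
    by_contra hlt
    have h2 : (2 : ℝ) ^ K ≤ 2 ^ (k + 1) := by
      gcongr
      · norm_num
      · simp at hlt; omega
    linarith
  have h0 : LPhat D 0 ξ = 1 - ∑' k : ℕ, LPhat D (k + 1) ξ := D.Φ_def ξ
  rw [h0, sub_sub_cancel]
  exact h

lemma hasSum_LPhat (D : LPData d) (ξ : RD d) : HasSum (fun k => LPhat D k ξ) 1 := by
  have := HasSum.zero_add (f := fun k => LPhat D k ξ) (hasSum_LPhat_succ D ξ)
  simpa using this

lemma LPhat_zero_support (D : LPData d) {ξ : RD d} (h : LPhat D 0 ξ ≠ 0) : ‖ξ‖ ≤ 2 := by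
  by_contra! hξ
  refine h ?_
  have hξ0 : ξ ≠ 0 := by rw [← norm_pos_iff]; linarith
  have h1 : HasSum (fun k : ℕ => LPhat D (k + 1) ξ) 1 := by
    have hinj : Function.Injective fun k : ℕ => ((k : ℤ) + 1) := fun a b h => by simpa using h
    have := (hinj.hasSum_iff (f := fun k : ℤ => fourierS D.φ ((2 : ℝ) ^ (-k) • ξ)) (a := 1) ?_).2
      (D.sum_φ ξ hξ0)
    · convert this using 2 with k
      simp only [Function.comp, LPhat]
      congr 2
    · intro k hk
      by_contra hne
      have h2 := (D.supp_φ _ hne).2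
      rw [norm_smul, norm_zpow, Real.norm_ofNat] at h2
      have hk0 : k ≤ 0 := by
        by_contra! hpos
        exact hk ⟨(k - 1).toNat, by simp only; omega⟩
      have h3 : (1 : ℝ) ≤ 2 ^ (-k) := one_le_zpow₀ one_le_two (by omega)
      nlinarith
  have := (hasSum_LPhat_succ D ξ).unique h1
  linear_combination -this

lemma exists_norm_LPhat_le (D : LPData d) : ∃ C : ℝ, 0 ≤ C ∧ ∀ k ξ, ‖LPhat D k ξ‖ ≤ C := by
  refine ⟨max (SchwartzMap.seminorm ℝ 0 0 (fourierS D.φ)) (SchwartzMap.seminorm ℝ 0 0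
    (fourierS D.Φ)), le_max_of_le_left (apply_nonneg _ _), fun k ξ => ?_⟩
  cases k with
  | zero => exact le_max_of_le_right (SchwartzMap.norm_le_seminorm ℝ _ _)
  | succ k => exact le_max_of_le_left (SchwartzMap.norm_le_seminorm ℝ _ _)

end pieces

/-! ### Symbol calculus -/

section symbols

variable {d : ℕ}

/-- Partial iterated derivatives of a jointly smooth function are jointly smooth. -/
lemma contDiff_iteratedFDeriv_left {b : RD d → RD d → ℂ}
    (hb : ContDiff ℝ ∞ (fun p : RD d × RD d => b p.1 p.2)) (β : ℕ) :
    ContDiff ℝ ∞ (fun p : RD d × RD d => iteratedFDeriv ℝ β (fun x' => b x' p.2) p.1) := by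
  induction β with
  | zero =>
    simp only [iteratedFDeriv_zero_eq_comp, Function.comp]
    exact (continuousMultilinearCurryFin0 ℝ (RD d) ℂ).symm.contDiff.comp hb
  | succ β ih =>
    simp only [iteratedFDeriv_succ_eq_comp_left, Function.comp]
    have he : ContDiff ℝ ∞
        (continuousMultilinearCurryLeftEquiv ℝ (fun _ : Fin (β + 1) => RD d) ℂ).symm :=
      LinearIsometryEquiv.contDiff _
    refine he.comp ?_
    refine ContDiff.fderiv (m := ∞) (f := fun (p : RD d × RD d) (x : RD d) =>
      iteratedFDeriv ℝ β (fun x' => b x' p.2) x) ?_ contDiff_fst (by simp)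
    exact ih.comp (contDiff_snd.prodMk (contDiff_snd.comp contDiff_fst))

lemma IsSymbolS11.contDiff_left {m : ℝ} {b : RD d → RD d → ℂ} (hb : IsSymbolS11 d m b)
    (ξ : RD d) : ContDiff ℝ ∞ (fun x => b x ξ) :=
  hb.1.comp (contDiff_id.prodMk contDiff_const)

lemma IsSymbolS11.contDiff_right {m : ℝ} {b : RD d → RD d → ℂ} (hb : IsSymbolS11 d m b)
    (x : RD d) : ContDiff ℝ ∞ (b x) :=
  hb.1.comp (contDiff_const.prodMk contDiff_id)

lemma IsSymbolS11.contDiff_iteratedFDeriv {m : ℝ} {b : RD d → RD d → ℂ} (hb : IsSymbolS11 d m b)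
    (β : ℕ) (x : RD d) : ContDiff ℝ ∞ (fun ξ => iteratedFDeriv ℝ β (fun x' => b x' ξ) x) :=
  (contDiff_iteratedFDeriv_left hb.1 β).comp (contDiff_const.prodMk contDiff_id)

lemma natCast_le_infty (n : ℕ) : (n : WithTop ℕ∞) ≤ ((⊤ : ℕ∞) : WithTop ℕ∞) := by
  exact_mod_cast le_top

lemma isSymbolS11_one : IsSymbolS11 d 0 (fun _ _ => 1) := by
  refine ⟨contDiff_const, fun α β => ⟨1, fun x ξ => ?_⟩⟩
  have hpos : 0 ≤ (1 : ℝ) * (1 + ‖ξ‖) ^ ((0 : ℝ) - (α : ℝ) + (β : ℝ)) := by positivity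
  rcases eq_or_ne α 0 with rfl | hα
  · rcases eq_or_ne β 0 with rfl | hβ
    · simp
    · simp only [iteratedFDeriv_const_of_ne hβ, norm_iteratedFDeriv_zero, Pi.zero_apply, norm_zero]
      exact hpos
  · simp only [iteratedFDeriv_const_of_ne hα, Pi.zero_apply, norm_zero]
    exact hpos

lemma IsSymbolS11.add {m : ℝ} {b c : RD d → RD d → ℂ} (hb : IsSymbolS11 d m b)
    (hc : IsSymbolS11 d m c) : IsSymbolS11 d m (fun x ξ => b x ξ + c x ξ) := by
  refine ⟨hb.1.add hc.1, fun α β => ?_⟩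
  obtain ⟨B, hB⟩ := hb.2 α β
  obtain ⟨C, hC⟩ := hc.2 α β
  refine ⟨B + C, fun x ξ => ?_⟩
  have h1 : (fun ξ' => iteratedFDeriv ℝ β (fun x' => b x' ξ' + c x' ξ') x) =
      (fun ξ' => iteratedFDeriv ℝ β (fun x' => b x' ξ') x) +
        fun ξ' => iteratedFDeriv ℝ β (fun x' => c x' ξ') x := by
    funext ξ'
    exact iteratedFDeriv_add_apply
      ((hb.contDiff_left ξ').contDiffAt.of_le (natCast_le_infty β))
      ((hc.contDiff_left ξ').contDiffAt.of_le (natCast_le_infty β))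
  rw [h1, iteratedFDeriv_add_apply
    ((hb.contDiff_iteratedFDeriv β x).contDiffAt.of_le (natCast_le_infty α))
    ((hc.contDiff_iteratedFDeriv β x).contDiffAt.of_le (natCast_le_infty α)), add_mul]
  exact (norm_add_le _ _).trans (add_le_add (hB x ξ) (hC x ξ))

lemma IsSymbolS11.const_smul {m : ℝ} {b : RD d → RD d → ℂ} (hb : IsSymbolS11 d m b) (c : ℂ) :
    IsSymbolS11 d m (fun x ξ => c • b x ξ) := by
  refine ⟨hb.1.const_smul c, fun α β => ?_⟩
  obtain ⟨B, hB⟩ := hb.2 α β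
  refine ⟨‖c‖ * B, fun x ξ => ?_⟩
  have h1 : (fun ξ' => iteratedFDeriv ℝ β (fun x' => c • b x' ξ') x) =
      c • (fun ξ' => iteratedFDeriv ℝ β (fun x' => b x' ξ') x) := by
    funext ξ'
    exact iteratedFDeriv_const_smul_apply (a := c)
      ((hb.contDiff_left ξ').contDiffAt.of_le (natCast_le_infty β))
  rw [h1, iteratedFDeriv_const_smul_apply
    ((hb.contDiff_iteratedFDeriv β x).contDiffAt.of_le (natCast_le_infty α)), norm_smul, mul_assoc]
  gcongr
  exact hB x ξ

lemma IsSymbolS11.fderiv_left {m : ℝ} {b : RD d → RD d → ℂ} (hb : IsSymbolS11 d m b) (v : RD d) :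
    IsSymbolS11 d (m + 1) (fun x ξ => fderiv ℝ (fun x' => b x' ξ) x v) := by
  have hsm : ∀ ξ, ContDiff ℝ ∞ (fderiv ℝ fun x' => b x' ξ) := fun ξ =>
    (hb.contDiff_left ξ).fderiv_right (by simp)
  refine ⟨?_, fun α β => ?_⟩
  · refine ContDiff.clm_apply (ContDiff.fderiv (m := ∞) (f := fun (p : RD d × RD d) (x : RD d) =>
      b x p.2) ?_ contDiff_fst (by simp)) contDiff_const
    exact hb.1.comp (contDiff_snd.prodMk (contDiff_snd.comp contDiff_fst))
  obtain ⟨B, hB⟩ := hb.2 α (β + 1)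
  let L : (RD d [×(β + 1)]→L[ℝ] ℂ) →L[ℝ] (RD d [×β]→L[ℝ] ℂ) :=
    (ContinuousLinearMap.compContinuousMultilinearMapL ℝ (fun _ : Fin β => RD d) (RD d →L[ℝ] ℂ) ℂ
      (ContinuousLinearMap.apply ℝ ℂ v)).comp
      (continuousMultilinearCurryRightEquiv' ℝ β (RD d) ℂ).toContinuousLinearEquiv.toContinuousLinearMap
  refine ⟨‖L‖ * B, fun x ξ => ?_⟩
  have h1 : (fun ξ' => iteratedFDeriv ℝ β (fun x'' => fderiv ℝ (fun x' => b x' ξ') x'' v) x) =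
      L ∘ (fun ξ' => iteratedFDeriv ℝ (β + 1) (fun x' => b x' ξ') x) := by
    funext ξ'
    have h2 := (ContinuousLinearMap.apply ℝ ℂ v).iteratedFDeriv_comp_left
      (f := fderiv ℝ fun x' => b x' ξ') (hsm ξ').contDiffAt (x := x) (natCast_le_infty β)
    refine Eq.trans h2 ?_
    simp only [Function.comp_apply, iteratedFDeriv_succ_eq_comp_right]
    simp [L]
  rw [h1]
  refine (L.norm_iteratedFDeriv_comp_left (hb.contDiff_iteratedFDeriv (β + 1) x).contDiffAt
    (natCast_le_infty α)).trans ?_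
  rw [mul_assoc]
  gcongr
  refine (hB x ξ).trans_eq ?_
  push_cast
  ring_nf

lemma norm_iteratedFDeriv_inner_le (v : RD d) (i : ℕ) (ξ : RD d) :
    ‖iteratedFDeriv ℝ i (fun ξ' : RD d => ⟪v, ξ'⟫) ξ‖ ≤ ‖v‖ * (1 + ‖ξ‖) ^ (1 - (i : ℝ)) := by
  have hf : fderiv ℝ (fun ξ' : RD d => ⟪v, ξ'⟫) = fun _ => innerSL ℝ v := by
    funext x
    exact (innerSL ℝ v).fderiv
  rcases i with _ | _ | i
  · rw [norm_iteratedFDeriv_zero]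
    refine (norm_inner_le_norm v ξ).trans ?_
    simp
    gcongr
    linarith [norm_nonneg ξ]
  · rw [← norm_iteratedFDeriv_fderiv, hf]
    simp
  · rw [← norm_iteratedFDeriv_fderiv, hf, iteratedFDeriv_const_of_ne (by simp)]
    simp
    positivity

lemma IsSymbolS11.inner_smul {m : ℝ} {b : RD d → RD d → ℂ} (hb : IsSymbolS11 d m b) (v : RD d) :
    IsSymbolS11 d (m + 1) (fun x ξ => (⟪v, ξ⟫ : ℝ) • b x ξ) := by
  refine ⟨ContDiff.smul (contDiff_const.inner ℝ contDiff_snd) hb.1, fun α β => ?_⟩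
  choose B hB using fun α => hb.2 α β
  refine ⟨∑ i ∈ Finset.range (α + 1), (α.choose i : ℝ) * ‖v‖ * B (α - i), fun x ξ => ?_⟩
  have h1 : (fun ξ' => iteratedFDeriv ℝ β (fun x' => (⟪v, ξ'⟫ : ℝ) • b x' ξ') x) =
      (fun ξ' => (⟪v, ξ'⟫ : ℝ) • iteratedFDeriv ℝ β (fun x' => b x' ξ') x) := by
    funext ξ'
    exact iteratedFDeriv_const_smul_apply (a := (⟪v, ξ'⟫ : ℝ))
      ((hb.contDiff_left ξ').contDiffAt.of_le (natCast_le_infty β))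
  rw [h1]
  refine (norm_iteratedFDeriv_smul_le (N := ∞)
    (contDiff_const.inner ℝ contDiff_id) (hb.contDiff_iteratedFDeriv β x) ξ
    (natCast_le_infty α)).trans ?_
  rw [Finset.sum_mul]
  refine Finset.sum_le_sum fun i hi => ?_
  have hi' : i ≤ α := Nat.lt_succ_iff.1 (Finset.mem_range.1 hi)
  have hpos : 0 < 1 + ‖ξ‖ := by positivity
  calc _ ≤ (α.choose i : ℝ) * (‖v‖ * (1 + ‖ξ‖) ^ (1 - (i : ℝ))) *
        (B (α - i) * (1 + ‖ξ‖) ^ (m - ((α - i : ℕ) : ℝ) + β)) := by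
        gcongr
        · exact norm_iteratedFDeriv_inner_le v i ξ
        · exact hB (α - i) x ξ
    _ = (α.choose i : ℝ) * ‖v‖ * B (α - i) *
        ((1 + ‖ξ‖) ^ (1 - (i : ℝ)) * (1 + ‖ξ‖) ^ (m - ((α - i : ℕ) : ℝ) + β)) := by ring
    _ = _ := by
        rw [← Real.rpow_add hpos, Nat.cast_sub hi']
        ring_nf

/-- The symbol of `∂_v ∘ T_b`. -/
def symbolDeriv (b : RD d → RD d → ℂ) (v : RD d) (x ξ : RD d) : ℂ :=
  fderiv ℝ (fun x' => b x' ξ) x v + (2 * Real.pi * Complex.I : ℂ) • ((⟪v, ξ⟫ : ℝ) • b x ξ)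

lemma IsSymbolS11.symbolDeriv {m : ℝ} {b : RD d → RD d → ℂ} (hb : IsSymbolS11 d m b) (v : RD d) :
    IsSymbolS11 d (m + 1) (symbolDeriv b v) :=
  (hb.fderiv_left v).add ((hb.inner_smul v).const_smul _)

/-- Bounds for the frequency derivatives of a symbol. -/
lemma IsSymbolS11.norm_iteratedFDeriv_le {m : ℝ} {b : RD d → RD d → ℂ} (hb : IsSymbolS11 d m b)
    (α : ℕ) : ∃ c : ℝ, 0 ≤ c ∧ ∀ x ξ : RD d,
      ‖iteratedFDeriv ℝ α (b x) ξ‖ ≤ c * (1 + ‖ξ‖) ^ (m - (α : ℝ)) := by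
  obtain ⟨c, hc⟩ := hb.2 α 0
  refine ⟨max c 0, le_max_right _ _, fun x ξ => ?_⟩
  have h := hc x ξ
  simp only [iteratedFDeriv_zero_eq_comp, Function.comp_apply] at h
  have h2 := LinearIsometryEquiv.norm_iteratedFDeriv_comp_left
    (continuousMultilinearCurryFin0 ℝ (RD d) ℂ).symm (b x) ξ α
  rw [← h2]
  refine h.trans ?_
  rw [Nat.cast_zero, add_zero]
  gcongr
  exact le_max_left _ _

lemma IsSymbolS11.norm_le {m : ℝ} {b : RD d → RD d → ℂ} (hb : IsSymbolS11 d m b) :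
    ∃ c : ℝ, 0 ≤ c ∧ ∀ x ξ : RD d, ‖b x ξ‖ ≤ c * (1 + ‖ξ‖) ^ m := by
  simpa using hb.norm_iteratedFDeriv_le 0

end symbols

/-! ### Kernel estimates for frequency-localized pieces -/

section kernel

open FourierTransform

variable {d : ℕ}

/-- Decay of the Fourier transform of a smooth function supported in a fixed ball. -/
lemma exists_norm_fourier_le (d N : ℕ) : ∃ C : ℝ, 0 ≤ C ∧ ∀ (g : RD d → ℂ) (B : ℝ),
    ContDiff ℝ ∞ g → tsupport g ⊆ Metric.closedBall 0 4 →
    (∀ n ≤ N, ∀ η, ‖iteratedFDeriv ℝ n g η‖ ≤ B) →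
    ∀ u, (1 + ‖u‖) ^ N * ‖𝓕 g u‖ ≤ C * B := by
  set V : ℝ := volume.real (Metric.closedBall (0 : RD d) 4) with hV
  have hV0 : 0 ≤ V := measureReal_nonneg
  refine ⟨2 ^ N * (V + 2 ^ N * ((N + 1) * V)), by positivity, fun g B hg hs hB u => ?_⟩
  have hB0 : 0 ≤ B := (norm_nonneg _).trans (hB 0 (Nat.zero_le _) 0)
  have hc : HasCompactSupport g := HasCompactSupport.of_support_subset_isCompact
    (isCompact_closedBall 0 4) ((subset_tsupport g).trans hs)
  have hcont : ∀ n : ℕ, Continuous fun v => ‖iteratedFDeriv ℝ n g v‖ := fun n =>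
    (hg.continuous_iteratedFDeriv (natCast_le_infty n)).norm
  have hint : ∀ n : ℕ, Integrable fun v => ‖iteratedFDeriv ℝ n g v‖ := fun n =>
    (hcont n).integrable_of_hasCompactSupport ((hc.iteratedFDeriv n).norm)
  have hbd : ∀ n ≤ N, ∫ v, ‖iteratedFDeriv ℝ n g v‖ ≤ B * V := by
    intro n hn
    have h1 : ∫ v, ‖iteratedFDeriv ℝ n g v‖ =
        ∫ v in Metric.closedBall (0 : RD d) 4, ‖iteratedFDeriv ℝ n g v‖ := by
      rw [setIntegral_eq_integral_of_forall_compl_eq_zero]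
      intro v hv
      by_contra hne
      exact hv (hs (support_iteratedFDeriv_subset n (norm_ne_zero_iff.1 hne)))
    rw [h1]
    calc _ ≤ ∫ v in Metric.closedBall (0 : RD d) 4, B := by
          refine setIntegral_mono (hint n).integrableOn ?_ fun v => hB n hn v
          exact integrableOn_const (isCompact_closedBall (0 : RD d) 4).measure_lt_top.ne
      _ = B * V := by simp [hV, mul_comm]
  have key : ∀ n ≤ N, ‖u‖ ^ n * ‖𝓕 g u‖ ≤ 2 ^ n * ((n + 1) * (B * V)) := by
    intro n hn
    have h := Real.pow_mul_norm_iteratedFDeriv_fourier_le (f := g) (K := 0) (N := (⊤ : ℕ∞)) hg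
      (fun k n hk _ => by
        have : k = 0 := by simpa using hk
        subst this
        simpa using hint n) (k := 0) (n := n) (by simp) (by simp) u
    rw [norm_iteratedFDeriv_zero] at h
    refine h.trans ?_
    have h2 : ∑ p ∈ Finset.range (0 + 1) ×ˢ Finset.range (n + 1),
        ∫ v, ‖v‖ ^ p.1 * ‖iteratedFDeriv ℝ p.2 g v‖ ≤ (n + 1) * (B * V) := by
      rw [Finset.sum_product]
      simp only [zero_add, Finset.range_one, Finset.sum_singleton, pow_zero, one_mul]
      refine (Finset.sum_le_card_nsmul _ _ (B * V) fun i hi => hbd i ?_).trans_eq ?_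
      · have := Finset.mem_range.1 hi
        omega
      · simp
    have h3 : (2 * Real.pi) ^ 0 * (2 * ((0 : ℕ) : ℝ) + 2) ^ n = (2 : ℝ) ^ n := by simp
    rw [h3]
    gcongr
  have h0 := key 0 (Nat.zero_le _)
  have hN := key N le_rfl
  simp only [pow_zero, one_mul, Nat.cast_zero, zero_add] at h0
  have h4 : (1 + ‖u‖) ^ N ≤ 2 ^ N * (1 + ‖u‖ ^ N) := by
    refine (add_pow_le zero_le_one (norm_nonneg u) N).trans ?_
    rw [one_pow]
    gcongr
    · norm_num
    · omega
  calc (1 + ‖u‖) ^ N * ‖𝓕 g u‖ ≤ 2 ^ N * (1 + ‖u‖ ^ N) * ‖𝓕 g u‖ := by gcongr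
    _ = 2 ^ N * (‖𝓕 g u‖ + ‖u‖ ^ N * ‖𝓕 g u‖) := by ring
    _ ≤ 2 ^ N * (B * V + 2 ^ N * ((N + 1) * (B * V))) := by gcongr
    _ = _ := by ring

/-- The smooth cutoff to a ball. -/
def ballBump (d : ℕ) : ContDiffBump (0 : RD d) := ⟨2, 4, by norm_num, by norm_num⟩

/-- The smooth cutoff to a small ball. -/
def smallBump (d : ℕ) : ContDiffBump (0 : RD d) := ⟨1 / 4, 1 / 2, by norm_num, by norm_num⟩

/-- A cutoff adapted to the rescaled support of the `k`-th Littlewood–Paley multiplier. -/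
def cutoff (k : ℕ) (η : RD d) : ℂ :=
  ((ballBump d η * if k = 0 then 1 else 1 - smallBump d η : ℝ) : ℂ)

lemma contDiff_cutoff (k : ℕ) : ContDiff ℝ ∞ (cutoff k : RD d → ℂ) := by
  unfold cutoff
  refine Complex.ofRealCLM.contDiff.comp ((ballBump d).contDiff.mul ?_)
  split_ifs
  · exact contDiff_const
  · exact contDiff_const.sub (smallBump d).contDiff

lemma cutoff_support (k : ℕ) {η : RD d} (h : cutoff k η ≠ 0) :
    ‖η‖ ≤ 4 ∧ (k ≠ 0 → 1 / 4 ≤ ‖η‖) := by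
  constructor
  · by_contra! hη
    refine h ?_
    have := (ballBump d).zero_of_le_dist (x := η) (by simpa [ballBump] using hη.le)
    simp [cutoff, this]
  · intro hk
    by_contra! hη
    refine h ?_
    have := (smallBump d).one_of_mem_closedBall (x := η) (by simpa [smallBump] using hη.le)
    simp [cutoff, this, hk]

lemma tsupport_cutoff (k : ℕ) :
    tsupport (cutoff k : RD d → ℂ) ⊆ {η | ‖η‖ ≤ 4 ∧ (k ≠ 0 → 1 / 4 ≤ ‖η‖)} := by
  refine closure_minimal (fun η hη => cutoff_support k hη) ?_
  refine (isClosed_le continuous_norm continuous_const).inter ?_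
  by_cases hk : k = 0
  · simp only [hk, ne_eq, not_true_eq_false, false_implies]
    exact isClosed_univ
  · simp only [ne_eq, hk, not_false_eq_true, true_implies]
    exact isClosed_le continuous_const continuous_norm

lemma cutoff_eq_one (k : ℕ) {η : RD d} (h2 : ‖η‖ ≤ 2) (h1 : k ≠ 0 → 1 / 2 ≤ ‖η‖) :
    cutoff k η = 1 := by
  have := (ballBump d).one_of_mem_closedBall (x := η) (by simpa [ballBump] using h2)
  by_cases hk : k = 0
  · simp [cutoff, this, hk]
  · have h3 := (smallBump d).zero_of_le_dist (x := η) (by simpa [smallBump] using h1 hk)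
    simp [cutoff, this, hk, h3]

lemma exists_norm_iteratedFDeriv_cutoff_le (d n : ℕ) :
    ∃ C : ℝ, ∀ k (η : RD d), ‖iteratedFDeriv ℝ n (cutoff k) η‖ ≤ C := by
  have h : ∀ k, ∃ C : ℝ, ∀ η : RD d, ‖iteratedFDeriv ℝ n (cutoff k) η‖ ≤ C := fun k => by
    have hc : HasCompactSupport (cutoff k : RD d → ℂ) :=
      HasCompactSupport.of_support_subset_isCompact (isCompact_closedBall 0 4)
        fun η hη => by simpa using (cutoff_support k hη).1
    exact (hc.iteratedFDeriv n).exists_bound_of_continuous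
      ((contDiff_cutoff k).continuous_iteratedFDeriv (natCast_le_infty n))
  obtain ⟨C0, h0⟩ := h 0
  obtain ⟨C1, h1⟩ := h 1
  refine ⟨max C0 C1, fun k η => ?_⟩
  rcases Nat.eq_zero_or_pos k with rfl | hk
  · exact (h0 η).trans (le_max_left _ _)
  · have : (cutoff k : RD d → ℂ) = cutoff 1 := by
      funext η
      simp [cutoff, hk.ne']
    rw [this]
    exact (h1 η).trans (le_max_right _ _)

lemma rpow_le_of_comparable {t r : ℝ} {k : ℕ} (h1 : 2 ^ k / 5 ≤ t) (h2 : t ≤ 5 * 2 ^ k) :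
    t ^ r ≤ 5 ^ |r| * ((2 : ℝ) ^ k) ^ r := by
  have hk : (0 : ℝ) < 2 ^ k := by positivity
  have ht : 0 < t := lt_of_lt_of_le (by positivity) h1
  rcases le_total 0 r with hr | hr
  · rw [abs_of_nonneg hr, ← Real.mul_rpow (by norm_num) hk.le]
    exact Real.rpow_le_rpow ht.le h2 hr
  · rw [abs_of_nonpos hr, Real.rpow_neg (by norm_num), ← Real.inv_rpow (by norm_num),
      ← Real.mul_rpow (by norm_num) hk.le]
    refine Real.rpow_le_rpow_of_nonpos (by positivity) ?_ hr
    linarith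

/-- The rescaled localized symbol `η ↦ b(x, 2^k η) χ(η)`. -/
def localSymbol (b : RD d → RD d → ℂ) (k : ℕ) (x η : RD d) : ℂ :=
  b x ((2 : ℝ) ^ k • η) * cutoff k η

lemma IsSymbolS11.contDiff_comp_smul {m : ℝ} {b : RD d → RD d → ℂ} (hb : IsSymbolS11 d m b)
    (k : ℕ) (x : RD d) : ContDiff ℝ ∞ (fun η => b x ((2 : ℝ) ^ k • η)) :=
  (hb.contDiff_right x).comp (contDiff_id.const_smul _)

lemma IsSymbolS11.contDiff_localSymbol {m : ℝ} {b : RD d → RD d → ℂ} (hb : IsSymbolS11 d m b)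
    (k : ℕ) (x : RD d) : ContDiff ℝ ∞ (localSymbol b k x) :=
  (hb.contDiff_comp_smul k x).mul (contDiff_cutoff k)

lemma tsupport_localSymbol (b : RD d → RD d → ℂ) (k : ℕ) (x : RD d) :
    tsupport (localSymbol b k x) ⊆ {η | ‖η‖ ≤ 4 ∧ (k ≠ 0 → 1 / 4 ≤ ‖η‖)} :=
  (closure_mono fun _ h => right_ne_zero_of_mul h).trans (tsupport_cutoff k)

lemma IsSymbolS11.exists_norm_iteratedFDeriv_localSymbol_le {m : ℝ} {b : RD d → RD d → ℂ}
    (hb : IsSymbolS11 d m b) (n : ℕ) : ∃ C : ℝ, ∀ k (x η : RD d),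
      ‖iteratedFDeriv ℝ n (localSymbol b k x) η‖ ≤ C * ((2 : ℝ) ^ k) ^ m := by
  choose c hc0 hc using hb.norm_iteratedFDeriv_le
  choose e he using exists_norm_iteratedFDeriv_cutoff_le d
  refine ⟨∑ i ∈ Finset.range (n + 1), (n.choose i : ℝ) * (c i * 5 ^ |m - i|) * e (n - i),
    fun k x η => ?_⟩
  have he0 : ∀ i, 0 ≤ e i := fun i => (norm_nonneg _).trans (he i 0 0)
  by_cases hη : η ∈ tsupport (localSymbol b k x)
  swap
  · have : iteratedFDeriv ℝ n (localSymbol b k x) η = 0 := by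
      by_contra hne
      exact hη (support_iteratedFDeriv_subset n hne)
    rw [this, norm_zero]
    refine mul_nonneg (Finset.sum_nonneg fun i _ => ?_) (by positivity)
    have := hc0 i
    have := he0 (n - i)
    positivity
  have hη' := tsupport_localSymbol b k x hη
  have hk : (0 : ℝ) < 2 ^ k := by positivity
  have hk1 : (1 : ℝ) ≤ 2 ^ k := one_le_pow₀ one_le_two
  refine (norm_iteratedFDeriv_mul_le (N := ∞) (hb.contDiff_comp_smul k x) (contDiff_cutoff k) η
    (natCast_le_infty n)).trans ?_
  rw [Finset.sum_mul]
  refine Finset.sum_le_sum fun i _ => ?_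
  have h1 : ‖iteratedFDeriv ℝ i (fun η => b x ((2 : ℝ) ^ k • η)) η‖ ≤
      c i * 5 ^ |m - i| * ((2 : ℝ) ^ k) ^ m := by
    rw [iteratedFDeriv_comp_const_smul _ ((hb.contDiff_right x).of_le (natCast_le_infty i)),
      norm_smul, norm_pow, Real.norm_of_nonneg hk.le]
    have h2 := hc i x ((2 : ℝ) ^ k • η)
    rw [norm_smul, Real.norm_of_nonneg hk.le] at h2
    have h3 : (1 + 2 ^ k * ‖η‖) ^ (m - i) ≤ 5 ^ |m - i| * ((2 : ℝ) ^ k) ^ (m - i) := by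
      apply rpow_le_of_comparable
      · rcases Nat.eq_zero_or_pos k with rfl | hpos
        · have := norm_nonneg η
          norm_num
          linarith
        · have := hη'.2 hpos.ne'
          nlinarith
      · nlinarith [hη'.1]
    calc ((2 : ℝ) ^ k) ^ i * ‖iteratedFDeriv ℝ i (b x) ((2 : ℝ) ^ k • η)‖
        ≤ ((2 : ℝ) ^ k) ^ i * (c i * (5 ^ |m - i| * ((2 : ℝ) ^ k) ^ (m - i))) := by
          gcongr
          refine h2.trans ?_
          have := hc0 i
          gcongr
      _ = c i * 5 ^ |m - i| * (((2 : ℝ) ^ k) ^ (i : ℝ) * ((2 : ℝ) ^ k) ^ (m - i)) := by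
          rw [Real.rpow_natCast]
          ring
      _ = _ := by
          rw [← Real.rpow_add hk]
          ring_nf
  calc _ ≤ (n.choose i : ℝ) * (c i * 5 ^ |m - i| * ((2 : ℝ) ^ k) ^ m) * e (n - i) := by
        gcongr
        · exact mul_nonneg (Nat.cast_nonneg _) ((norm_nonneg _).trans h1)
        · exact he _ _ _
    _ = _ := by ring

end kernel

/-! ### Pointwise bounds for `pdo` on frequency-localized functions -/

section pieces

open FourierTransform

variable {d : ℕ}

/-- The modulated and localized symbol `ξ ↦ b(x, ξ) χ(2^{-k} ξ) e^{2πi⟨x, ξ⟩}`. -/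
def modSymbol (b : RD d → RD d → ℂ) (k : ℕ) (x ξ : RD d) : ℂ :=
  localSymbol b k x (((2 : ℝ) ^ k)⁻¹ • ξ) *
    Complex.exp (2 * Real.pi * Complex.I * ((⟪x, ξ⟫ : ℝ) : ℂ))

lemma contDiff_exp_inner (x : RD d) : ContDiff ℝ ∞ fun ξ : RD d =>
    Complex.exp (2 * Real.pi * Complex.I * ((⟪x, ξ⟫ : ℝ) : ℂ)) := by
  refine ContDiff.cexp (contDiff_const.mul (Complex.ofRealCLM.contDiff.comp ?_))
  exact contDiff_const.inner ℝ contDiff_id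

lemma IsSymbolS11.contDiff_modSymbol {m : ℝ} {b : RD d → RD d → ℂ} (hb : IsSymbolS11 d m b)
    (k : ℕ) (x : RD d) : ContDiff ℝ ∞ (modSymbol b k x) :=
  ((hb.contDiff_localSymbol k x).comp (contDiff_id.const_smul _)).mul (contDiff_exp_inner x)

lemma hasCompactSupport_modSymbol (b : RD d → RD d → ℂ) (k : ℕ) (x : RD d) :
    HasCompactSupport (modSymbol b k x) := by
  refine HasCompactSupport.of_support_subset_isCompact
    (isCompact_closedBall (0 : RD d) (2 ^ k * 4)) fun ξ hξ => ?_
  have h := (tsupport_localSymbol b k x (subset_tsupport _ (left_ne_zero_of_mul hξ))).1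
  rw [norm_smul, norm_inv, norm_pow, Real.norm_ofNat, inv_mul_le_iff₀ (by positivity)] at h
  simpa using h

/-- `modSymbol` as a Schwartz function. -/
def modSymbolS {m : ℝ} {b : RD d → RD d → ℂ} (hb : IsSymbolS11 d m b) (k : ℕ) (x : RD d) :
    𝓢(RD d, ℂ) :=
  (hasCompactSupport_modSymbol b k x).toSchwartzMap (hb.contDiff_modSymbol k x)

lemma cutoff_eq_one_of_LPhat_ne_zero (D : LPData d) {k : ℕ} {ξ : RD d} (h : LPhat D k ξ ≠ 0) :
    cutoff k (((2 : ℝ) ^ k)⁻¹ • ξ) = 1 := by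
  have hn : ‖((2 : ℝ) ^ k)⁻¹ • ξ‖ = ((2 : ℝ) ^ k)⁻¹ * ‖ξ‖ := by
    rw [norm_smul, norm_inv, norm_pow, Real.norm_ofNat]
  cases k with
  | zero => exact cutoff_eq_one 0 (by simpa using LPhat_zero_support D h) (by simp)
  | succ k =>
    obtain ⟨h1, h2⟩ := LPhat_succ_support D k h
    refine cutoff_eq_one _ ?_ fun _ => ?_
    · rw [hn, inv_mul_le_iff₀ (by positivity)]
      linarith
    · rw [hn, le_inv_mul_iff₀ (by positivity)]
      linarith

lemma pdo_pieceS_eq {m : ℝ} {b : RD d → RD d → ℂ} (hb : IsSymbolS11 d m b) (D : LPData d)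
    (k : ℕ) (f : 𝓢(RD d, ℂ)) (x : RD d) :
    pdo b (pieceS D k f) x = ∫ y, fourierS (modSymbolS hb k x) y * pieceS D k f y := by
  refine Eq.trans ?_ (SchwartzMap.integral_fourier_mul_eq (modSymbolS hb k x)
    (pieceS D k f)).symm
  refine integral_congr_ae (ae_of_all _ fun ξ => ?_)
  change b x ξ * fourierS (pieceS D k f) ξ * _ = modSymbol b k x ξ * fourierS (pieceS D k f) ξ
  rw [fourierS_pieceS]
  by_cases h : LPhat D k ξ = 0
  · simp [h]
  · rw [modSymbol, localSymbol, cutoff_eq_one_of_LPhat_ne_zero D h, smul_inv_smul₀ (by positivity)]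
    ring

lemma fourierS_modSymbolS {m : ℝ} {b : RD d → RD d → ℂ} (hb : IsSymbolS11 d m b)
    (k : ℕ) (x y : RD d) :
    fourierS (modSymbolS hb k x) y =
      (((2 : ℝ) ^ (k * d) : ℝ) : ℂ) * 𝓕 (localSymbol b k x) ((2 : ℝ) ^ k • (y - x)) := by
  rw [fourierS_apply, ← integral_dilate k, Real.fourier_eq', ← integral_const_mul]
  refine integral_congr_ae (ae_of_all _ fun η => ?_)
  change _ * (_ * modSymbol b k x ((2 : ℝ) ^ k • η)) = _
  beta_reduce
  rw [modSymbol, inv_smul_smul₀ (by positivity), smul_eq_mul, mul_comm (localSymbol _ _ _ _),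
    ← mul_assoc (Complex.exp _), ← Complex.exp_add]
  congr 3
  simp only [inner_smul_left, inner_smul_right, inner_sub_right, real_inner_comm η x]
  push_cast
  simp
  ring

/-- Kernel estimate: `pdo b` on the `k`-th Littlewood–Paley piece is controlled by
`2^{km}` times a weighted average at scale `2^{-k}`. -/
lemma IsSymbolS11.exists_enorm_pdo_pieceS_le {m : ℝ} {b : RD d → RD d → ℂ}
    (hb : IsSymbolS11 d m b) (D : LPData d) (N : ℝ) : ∃ C : ℝ≥0∞, C ≠ ⊤ ∧ ∀ k f x,
      ‖pdo b (pieceS D k f) x‖ₑ ≤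
        C * (2 : ℝ≥0∞) ^ ((k : ℝ) * m) * wavg k N (fun y => ‖pieceS D k f y‖ₑ) x := by
  obtain ⟨M, hM⟩ := exists_nat_ge N
  obtain ⟨C, hC0, hC⟩ := exists_norm_fourier_le d M
  choose c hc using hb.exists_norm_iteratedFDeriv_localSymbol_le
  set B : ℝ := ∑ n ∈ Finset.range (M + 1), |c n| with hB
  have hB' : ∀ n ≤ M, ∀ k x η, ‖iteratedFDeriv ℝ n (localSymbol b k x) η‖ ≤
      B * ((2 : ℝ) ^ k) ^ m := by
    intro n hn k x η
    refine (hc n k x η).trans ?_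
    gcongr
    exact (le_abs_self _).trans (Finset.single_le_sum (f := fun n => |c n|)
      (fun i _ => abs_nonneg _) (Finset.mem_range.2 (by omega)))
  refine ⟨ENNReal.ofReal (C * B), ENNReal.ofReal_ne_top, fun k f x => ?_⟩
  refine le_trans ?_ (mul_le_mul_right (wavg_antitone_exponent k hM _ x) _)
  rw [pdo_pieceS_eq hb D k f x, wavg, ← lintegral_const_mul' _ _
    (ENNReal.mul_ne_top ENNReal.ofReal_ne_top (two_rpow_ne_top _))]
  refine (enorm_integral_le_lintegral_enorm _).trans (lintegral_mono fun y => ?_)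
  rw [enorm_mul, ← mul_assoc]
  refine mul_le_mul_left ?_ _
  have h1 := hC (localSymbol b k x) _ (hb.contDiff_localSymbol k x)
    (fun η hη => by simpa using (tsupport_localSymbol b k x hη).1)
    (fun n hn η => hB' n hn k x η) ((2 : ℝ) ^ k • (y - x))
  rw [fourierS_modSymbolS, wt_sub_comm, wt_eq_ofReal, ← ofReal_two_rpow, ← ofReal_two_rpow,
    ← ENNReal.ofReal_mul (by positivity), ← ENNReal.ofReal_mul (by positivity),
    ← ENNReal.ofReal_mul (by positivity), ← ofReal_norm]
  refine ENNReal.ofReal_le_ofReal ?_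
  rw [norm_smul, norm_pow, Real.norm_ofNat] at h1
  have hp : (0 : ℝ) < 1 + 2 ^ k * ‖y - x‖ := by positivity
  rw [norm_mul, Complex.norm_real, Real.norm_of_nonneg (by positivity), Real.rpow_neg hp.le,
    Real.rpow_natCast, Real.rpow_mul (by norm_num) (k : ℝ) m, Real.rpow_natCast,
    Real.rpow_mul (by norm_num) (k : ℝ) (d : ℝ), Real.rpow_natCast, Real.rpow_natCast, pow_mul]
  rw [← le_div_iff₀' (by positivity)] at h1
  calc _ ≤ ((2 : ℝ) ^ k) ^ d * (C * (B * ((2 : ℝ) ^ k) ^ m) / (1 + 2 ^ k * ‖y - x‖) ^ M) := by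
        gcongr
    _ = _ := by rw [div_eq_mul_inv]; ring

lemma pdo_one (f : 𝓢(RD d, ℂ)) (x : RD d) : pdo (fun _ _ => 1) f x = f x := by
  have h : 𝓕⁻ (𝓕 f) = f := FourierTransform.fourierInv_fourier_eq f
  conv_rhs => rw [← h]
  rw [SchwartzMap.fourierInv_coe, Real.fourierInv_eq']
  refine integral_congr_ae (ae_of_all _ fun ξ => ?_)
  beta_reduce
  rw [one_mul, smul_eq_mul, mul_comm, real_inner_comm]
  congr 2
  push_cast
  ring

lemma exists_enorm_pieceS_le (D : LPData d) (N : ℝ) : ∃ C : ℝ≥0∞, C ≠ ⊤ ∧ ∀ k f x,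
    ‖pieceS D k f x‖ₑ ≤ C * wavg k N (fun y => ‖pieceS D k f y‖ₑ) x := by
  obtain ⟨C, hC, h⟩ := (isSymbolS11_one (d := d)).exists_enorm_pdo_pieceS_le D N
  exact ⟨C, hC, fun k f x => by simpa [pdo_one] using h k f x⟩

end pieces

/-! ### Convolution of mollifiers with pseudo-differential operators -/

section mollify

open FourierTransform LineDeriv

variable {d : ℕ}

lemma integrable_rpow_mul_schwartz (F : 𝓢(RD d, ℂ)) (m : ℝ) :
    Integrable fun ξ : RD d => (1 + ‖ξ‖) ^ m * ‖F ξ‖ := by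
  obtain ⟨M, hM⟩ := exists_nat_ge m
  have h := ((F.integrable_pow_mul volume 0).add (F.integrable_pow_mul volume M)).const_mul
    ((2 : ℝ) ^ M)
  have hcont : Continuous fun ξ : RD d => (1 + ‖ξ‖) ^ m * ‖F ξ‖ := by
    refine Continuous.mul (Continuous.rpow_const (by fun_prop) fun ξ => Or.inl ?_) (by fun_prop)
    positivity
  refine h.mono' hcont.aestronglyMeasurable (ae_of_all _ fun ξ => ?_)
  rw [Real.norm_of_nonneg (by positivity)]
  have h1 : (1 + ‖ξ‖) ^ m ≤ 2 ^ M * (1 + ‖ξ‖ ^ M) := by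
    calc (1 + ‖ξ‖) ^ m ≤ (1 + ‖ξ‖) ^ (M : ℝ) :=
          Real.rpow_le_rpow_of_exponent_le (by linarith [norm_nonneg ξ]) hM
      _ = (1 + ‖ξ‖) ^ M := Real.rpow_natCast _ _
      _ ≤ 2 ^ (M - 1) * (1 ^ M + ‖ξ‖ ^ M) := add_pow_le zero_le_one (norm_nonneg ξ) M
      _ ≤ _ := by
          rw [one_pow]
          gcongr
          · norm_num
          · omega
  calc (1 + ‖ξ‖) ^ m * ‖F ξ‖ ≤ 2 ^ M * (1 + ‖ξ‖ ^ M) * ‖F ξ‖ := by gcongr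
    _ = _ := by
      simp only [Pi.add_apply, pow_zero]
      ring

lemma norm_exp_inner (x ξ : RD d) :
    ‖Complex.exp (2 * Real.pi * Complex.I * ((⟪x, ξ⟫ : ℝ) : ℂ))‖ = 1 := by
  have : (2 * Real.pi * Complex.I * ((⟪x, ξ⟫ : ℝ) : ℂ)) =
      ((2 * Real.pi * ⟪x, ξ⟫ : ℝ) : ℂ) * Complex.I := by
    push_cast
    ring
  rw [this, Complex.norm_exp_ofReal_mul_I]

/-- The integrand of `pdo`. -/
def pdoIntegrand (b : RD d → RD d → ℂ) (F : 𝓢(RD d, ℂ)) (x ξ : RD d) : ℂ :=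
  b x ξ * fourierS F ξ * Complex.exp (2 * Real.pi * Complex.I * ((⟪x, ξ⟫ : ℝ) : ℂ))

lemma IsSymbolS11.continuous_pdoIntegrand {m : ℝ} {b : RD d → RD d → ℂ} (hb : IsSymbolS11 d m b)
    (F : 𝓢(RD d, ℂ)) : Continuous fun p : RD d × RD d => pdoIntegrand b F p.1 p.2 := by
  have h1 : Continuous fun p : RD d × RD d => b p.1 p.2 := hb.1.continuous
  unfold pdoIntegrand
  fun_prop

lemma IsSymbolS11.norm_pdoIntegrand_le {m : ℝ} {b : RD d → RD d → ℂ} (hb : IsSymbolS11 d m b) :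
    ∃ c : ℝ, 0 ≤ c ∧ ∀ (F : 𝓢(RD d, ℂ)) x ξ,
      ‖pdoIntegrand b F x ξ‖ ≤ c * ((1 + ‖ξ‖) ^ m * ‖fourierS F ξ‖) := by
  obtain ⟨c, hc0, hc⟩ := hb.norm_le
  refine ⟨c, hc0, fun F x ξ => ?_⟩
  rw [pdoIntegrand, norm_mul, norm_exp_inner, mul_one, norm_mul, ← mul_assoc]
  gcongr
  exact hc x ξ

lemma IsSymbolS11.integrable_pdoIntegrand {m : ℝ} {b : RD d → RD d → ℂ} (hb : IsSymbolS11 d m b)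
    (F : 𝓢(RD d, ℂ)) (x : RD d) : Integrable (pdoIntegrand b F x) := by
  obtain ⟨c, -, hc⟩ := hb.norm_pdoIntegrand_le
  exact ((integrable_rpow_mul_schwartz (fourierS F) m).const_mul c).mono'
    ((hb.continuous_pdoIntegrand F).comp (Continuous.prodMk_right x)).aestronglyMeasurable
    (ae_of_all _ fun ξ => hc F x ξ)

lemma IsSymbolS11.norm_pdo_le {m : ℝ} {b : RD d → RD d → ℂ} (hb : IsSymbolS11 d m b)
    (F : 𝓢(RD d, ℂ)) : ∃ B : ℝ, ∀ x, ‖pdo b F x‖ ≤ B := by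
  obtain ⟨c, -, hc⟩ := hb.norm_pdoIntegrand_le
  exact ⟨_, fun x => norm_integral_le_of_norm_le
    ((integrable_rpow_mul_schwartz (fourierS F) m).const_mul c) (ae_of_all _ fun ξ => hc F x ξ)⟩

lemma IsSymbolS11.continuous_pdo {m : ℝ} {b : RD d → RD d → ℂ} (hb : IsSymbolS11 d m b)
    (F : 𝓢(RD d, ℂ)) : Continuous (pdo b F) := by
  obtain ⟨c, -, hc⟩ := hb.norm_pdoIntegrand_le
  exact continuous_of_dominated (F := pdoIntegrand b F)
    (fun x => (hb.integrable_pdoIntegrand F x).1) (fun x => ae_of_all _ fun ξ => hc F x ξ)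
    ((integrable_rpow_mul_schwartz (fourierS F) m).const_mul c)
    (ae_of_all _ fun ξ => (hb.continuous_pdoIntegrand F).comp (Continuous.prodMk_left ξ))

lemma IsSymbolS11.hasLineDerivAt_pdo {m : ℝ} {b : RD d → RD d → ℂ} (hb : IsSymbolS11 d m b)
    (F : 𝓢(RD d, ℂ)) (x v : RD d) :
    HasLineDerivAt ℝ (pdo b F) (pdo (_root_.symbolDeriv b v) F x) x v := by
  obtain ⟨c, -, hc⟩ := (hb.symbolDeriv v).norm_pdoIntegrand_le
  have h := (hasDerivAt_integral_of_dominated_loc_of_deriv_le (μ := volume) (𝕜 := ℝ)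
    (F := fun t : ℝ => pdoIntegrand b F (x + t • v))
    (F' := fun t : ℝ => pdoIntegrand (_root_.symbolDeriv b v) F (x + t • v)) (x₀ := 0)
    (s := Set.univ) Filter.univ_mem
    (Filter.Eventually.of_forall fun t => (hb.integrable_pdoIntegrand F _).1)
    (hb.integrable_pdoIntegrand F _) ((hb.symbolDeriv v).integrable_pdoIntegrand F _).1
    (ae_of_all _ fun ξ t _ => hc F _ ξ)
    ((integrable_rpow_mul_schwartz (fourierS F) (m + 1)).const_mul c)
    (ae_of_all _ fun ξ t _ => ?_)).2
  · rw [HasLineDerivAt]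
    simpa [pdo, pdoIntegrand] using h
  · have hl : HasDerivAt (fun t : ℝ => x + t • v) v t := by
      simpa using ((hasDerivAt_id t).smul_const v).const_add x
    have h1 : HasDerivAt (fun t : ℝ => b (x + t • v) ξ)
        (fderiv ℝ (fun x' => b x' ξ) (x + t • v) v) t :=
      (((hb.contDiff_left ξ).differentiable (by simp)) _).hasFDerivAt.comp_hasDerivAt t hl
    have h2 : HasDerivAt (fun t : ℝ => ((⟪x + t • v, ξ⟫ : ℝ) : ℂ)) ((⟪v, ξ⟫ : ℝ) : ℂ) t := by
      refine HasDerivAt.ofReal_comp ?_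
      simpa using hl.inner ℝ (hasDerivAt_const t ξ)
    have h3 := (h1.mul_const (fourierS F ξ)).mul ((h2.const_mul
      (2 * Real.pi * Complex.I : ℂ)).cexp)
    refine h3.congr_deriv ?_
    simp only [pdoIntegrand, _root_.symbolDeriv, smul_eq_mul, Complex.real_smul]
    ring

lemma exists_primitives {ψ : 𝓢(RD d, ℂ)} (hψ : ∀ ξ, fourierS ψ ξ ≠ 0 → 1 / 2 ≤ ‖ξ‖ ∧ ‖ξ‖ ≤ 2) :
    ∃ Ψ : Fin d → 𝓢(RD d, ℂ),
      (∀ i ξ, fourierS (Ψ i) ξ ≠ 0 → 1 / 2 ≤ ‖ξ‖ ∧ ‖ξ‖ ≤ 2) ∧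
      ψ = ∑ i, ∂_{EuclideanSpace.single i (1 : ℝ)} (Ψ i) := by
  set den : RD d → ℝ := fun ξ => smallBump d ξ + ‖ξ‖ ^ 2 with hden
  have hpos : ∀ ξ, den ξ ≠ 0 := fun ξ => by
    rcases eq_or_ne ξ 0 with rfl | h
    · have : smallBump d 0 = 1 := (smallBump d).one_of_mem_closedBall (by simp [smallBump])
      simp [hden, this]
    · have := (smallBump d).nonneg (x := ξ)
      have := norm_pos_iff.2 h
      positivity
  have hdd : ContDiff ℝ ∞ den := (smallBump d).contDiff.add (contDiff_norm_sq ℝ)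
  set hat : Fin d → RD d → ℂ := fun i ξ =>
    (2 * Real.pi * Complex.I : ℂ)⁻¹ * ((ξ i / den ξ : ℝ) : ℂ) * fourierS ψ ξ with hhat
  have hsupp : ∀ i ξ, hat i ξ ≠ 0 → 1 / 2 ≤ ‖ξ‖ ∧ ‖ξ‖ ≤ 2 := fun i ξ h =>
    hψ ξ (right_ne_zero_of_mul h)
  have hcs : ∀ i, HasCompactSupport (hat i) := fun i =>
    HasCompactSupport.of_support_subset_isCompact (isCompact_closedBall 0 2)
      fun ξ hξ => by simpa using (hsupp i ξ hξ).2
  have hsm : ∀ i, ContDiff ℝ ∞ (hat i) := fun i => by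
    have h1 : ContDiff ℝ ∞ fun ξ : RD d => ξ i := by fun_prop
    exact (contDiff_const.mul (Complex.ofRealCLM.contDiff.comp (h1.div hdd hpos))).mul
      (fourierS ψ).smooth'
  have hF : ∀ i, 𝓕 (𝓕⁻ ((hcs i).toSchwartzMap (hsm i))) = (hcs i).toSchwartzMap (hsm i) :=
    fun i => FourierTransform.fourier_fourierInv_eq _
  refine ⟨fun i => 𝓕⁻ ((hcs i).toSchwartzMap (hsm i)), fun i ξ h => ?_, ?_⟩
  · refine hsupp i ξ ?_
    have h' : 𝓕 (𝓕⁻ ((hcs i).toSchwartzMap (hsm i))) ξ ≠ 0 := h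
    rw [hF] at h'
    exact h'
  · have hinj : Function.Injective (fun g : 𝓢(RD d, ℂ) => 𝓕 g) := fun g h e => by
      have := congrArg (fun g : 𝓢(RD d, ℂ) => 𝓕⁻ g) e
      simpa using this
    refine hinj ?_
    beta_reduce
    have hsum : 𝓕 (∑ i, ∂_{EuclideanSpace.single i (1 : ℝ)} (𝓕⁻ ((hcs i).toSchwartzMap (hsm i)))) =
        ∑ i, 𝓕 (∂_{EuclideanSpace.single i (1 : ℝ)} (𝓕⁻ ((hcs i).toSchwartzMap (hsm i)))) :=
      map_sum (FourierTransform.fourierCLE ℂ 𝓢(RD d, ℂ)) _ _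
    rw [hsum]
    ext ξ
    rw [_root_.sum_apply]
    have hterm : ∀ i, 𝓕 (∂_{EuclideanSpace.single i (1 : ℝ)}
        (𝓕⁻ ((hcs i).toSchwartzMap (hsm i)))) ξ = ((ξ i ^ 2 / den ξ : ℝ) : ℂ) * fourierS ψ ξ := by
      intro i
      rw [SchwartzMap.fourier_lineDerivOp_eq, hF, _root_.smul_apply,
        SchwartzMap.smulLeftCLM_apply_apply (by fun_prop)]
      change _ • (inner ℝ ξ (EuclideanSpace.single i (1 : ℝ)) • hat i ξ) = _
      have h2 : (2 * Real.pi * Complex.I : ℂ) ≠ 0 := Complex.two_pi_I_ne_zero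
      simp only [hhat, EuclideanSpace.inner_single_right, smul_eq_mul, Complex.real_smul]
      push_cast
      field_simp
      simp [sq]
    simp only [hterm]
    rw [← Finset.sum_mul, ← Complex.ofReal_sum, ← Finset.sum_div]
    change fourierS ψ ξ = _
    by_cases h0 : fourierS ψ ξ = 0
    · simp [h0]
    · have h1 := (hψ ξ h0).1
      have h2 : smallBump d ξ = 0 :=
        (smallBump d).zero_of_le_dist (by simpa [smallBump] using h1)
      have h3 : den ξ = ‖ξ‖ ^ 2 := by simp [hden, h2]
      have h4 : ∑ i, ξ i ^ 2 = ‖ξ‖ ^ 2 := by simp [EuclideanSpace.norm_sq_eq]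
      have h5 : ‖ξ‖ ≠ 0 := by linarith
      rw [h3, h4, div_self (pow_ne_zero 2 h5)]
      simp

end mollify

/-! ### Almost orthogonality -/

section orthogonality

open FourierTransform LineDeriv

variable {d : ℕ}

lemma exists_enorm_schwartz_le (ψ : 𝓢(RD d, ℂ)) (N : ℝ) : ∃ C : ℝ≥0∞, C ≠ ⊤ ∧ ∀ j y,
    ‖dilateS j ψ y‖ₑ ≤ C * ((2 : ℝ≥0∞) ^ ((j : ℝ) * d) * wt j N y) := by
  obtain ⟨M, hM⟩ := exists_nat_ge N
  set B := 2 ^ M * ((Finset.Iic (M, 0)).sup fun m => SchwartzMap.seminorm ℝ m.1 m.2) ψ with hB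
  refine ⟨ENNReal.ofReal B, ENNReal.ofReal_ne_top, fun j y => ?_⟩
  refine le_trans ?_ (mul_le_mul_right (mul_le_mul_right (wt_antitone_exponent j hM y) _) _)
  have h1 := SchwartzMap.one_add_le_sup_seminorm_apply (𝕜 := ℝ) (m := (M, 0)) (k := M) (n := 0)
    le_rfl le_rfl ψ ((2 : ℝ) ^ j • y)
  have hB0 : 0 ≤ B := by positivity
  rw [← hB, norm_iteratedFDeriv_zero, norm_smul, norm_pow, Real.norm_ofNat] at h1
  have hp : (0 : ℝ) < 1 + 2 ^ j * ‖y‖ := by positivity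
  rw [dilateS_apply, wt_eq_ofReal, ← ofReal_two_rpow, ← ENNReal.ofReal_mul (by positivity),
    ← ENNReal.ofReal_mul hB0, ← ofReal_norm]
  refine ENNReal.ofReal_le_ofReal ?_
  rw [norm_mul, Complex.norm_real, Real.norm_of_nonneg (by positivity), Real.rpow_neg hp.le,
    Real.rpow_natCast, Real.rpow_mul (by norm_num) (j : ℝ) (d : ℝ), Real.rpow_natCast,
    Real.rpow_natCast, pow_mul]
  rw [← le_div_iff₀' (by positivity)] at h1
  calc _ ≤ ((2 : ℝ) ^ j) ^ d * (B / (1 + 2 ^ j * ‖y‖) ^ M) := by gcongr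
    _ = _ := by rw [div_eq_mul_inv]; ring

lemma IsSymbolS11.exists_enorm_mollify_le {m : ℝ} {b : RD d → RD d → ℂ}
    (hb : IsSymbolS11 d m b) (D : LPData d) (ψ : 𝓢(RD d, ℂ)) (N : ℝ) :
    ∃ C : ℝ≥0∞, C ≠ ⊤ ∧ ∀ j k f x,
      ‖∫ y, dilateS j ψ y * pdo b (pieceS D k f) (x - y)‖ₑ ≤
        C * (2 : ℝ≥0∞) ^ ((k : ℝ) * m) * wavg (min j k) N (fun y => ‖pieceS D k f y‖ₑ) x := by
  set N' := max N 0 with hN'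
  obtain ⟨C₁, hC₁, h₁⟩ := exists_enorm_schwartz_le ψ (N' + (d + 1))
  obtain ⟨C₂, hC₂, h₂⟩ := hb.exists_enorm_pdo_pieceS_le D (N' + (d + 1))
  refine ⟨C₁ * C₂ * wtMass d (d + 1), ENNReal.mul_ne_top (ENNReal.mul_ne_top hC₁ hC₂)
    (wtMass_ne_top (by linarith)), fun j k f x => ?_⟩
  set h : RD d → ℝ≥0∞ := fun y => ‖pieceS D k f y‖ₑ with hh
  have hm : Measurable h := (pieceS D k f).continuous.enorm.measurable
  calc ‖∫ y, dilateS j ψ y * pdo b (pieceS D k f) (x - y)‖ₑ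
      ≤ ∫⁻ y, ‖dilateS j ψ y * pdo b (pieceS D k f) (x - y)‖ₑ :=
        enorm_integral_le_lintegral_enorm _
    _ ≤ ∫⁻ y, C₁ * ((2 : ℝ≥0∞) ^ ((j : ℝ) * d) * wt j (N' + (d + 1)) (x - (x - y)) *
          (C₂ * (2 : ℝ≥0∞) ^ ((k : ℝ) * m) * wavg k (N' + (d + 1)) h (x - y))) := by
        refine lintegral_mono fun y => ?_
        rw [enorm_mul, sub_sub_cancel, ← mul_assoc]
        exact mul_le_mul' (h₁ j y) (h₂ k f _)
    _ = ∫⁻ z, C₁ * ((2 : ℝ≥0∞) ^ ((j : ℝ) * d) * wt j (N' + (d + 1)) (x - z) *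
          (C₂ * (2 : ℝ≥0∞) ^ ((k : ℝ) * m) * wavg k (N' + (d + 1)) h z)) :=
        lintegral_sub_left_eq_self (fun z => C₁ * ((2 : ℝ≥0∞) ^ ((j : ℝ) * d) *
          wt j (N' + (d + 1)) (x - z) *
          (C₂ * (2 : ℝ≥0∞) ^ ((k : ℝ) * m) * wavg k (N' + (d + 1)) h z))) x
    _ = C₁ * (C₂ * (2 : ℝ≥0∞) ^ ((k : ℝ) * m) *
          wavg j (N' + (d + 1)) (wavg k (N' + (d + 1)) h) x) := by
        rw [lintegral_const_mul' _ _ hC₁, ← wavg_const_mul _ _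
          (ENNReal.mul_ne_top hC₂ (two_rpow_ne_top _))]
        rfl
    _ ≤ C₁ * (C₂ * (2 : ℝ≥0∞) ^ ((k : ℝ) * m) *
          (wtMass d (d + 1) * wavg (min j k) N h x)) := by
        gcongr
        exact (wavg_wavg_le j k (le_max_right _ _) hm x).trans
          (mul_le_mul_right (wavg_antitone_exponent _ (le_max_left _ _) _ _) _)
    _ = _ := by ring

lemma hasLineDerivAt_dilateS (j : ℕ) (ψ : 𝓢(RD d, ℂ)) (v y : RD d) :
    HasLineDerivAt ℝ (dilateS j ψ) (((2 : ℝ) ^ j : ℝ) * dilateS j (∂_{v} ψ) y) y v := by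
  have h1 : HasFDerivAt ψ (fderiv ℝ ψ ((2 : ℝ) ^ j • y)) ((2 : ℝ) ^ j • (y + (0 : ℝ) • v)) := by
    simpa using (ψ.differentiable _).hasFDerivAt
  have h2 : HasDerivAt (fun t : ℝ => (2 : ℝ) ^ j • (y + t • v)) ((2 : ℝ) ^ j • v) 0 := by
    have := (((hasDerivAt_id (0 : ℝ)).smul_const v).const_add y).const_smul ((2 : ℝ) ^ j)
    rw [one_smul] at this
    exact this
  have h3 := (h1.comp_hasDerivAt (0 : ℝ) h2).const_mul ((((2 : ℝ) ^ (j * d) : ℝ) : ℂ))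
  rw [HasLineDerivAt]
  refine h3.congr_deriv ?_
  rw [dilateS_apply, SchwartzMap.lineDerivOp_apply_eq_fderiv, map_smul, Complex.real_smul]
  ring

lemma IsSymbolS11.integrable_mul_pdo {m : ℝ} {b : RD d → RD d → ℂ} (hb : IsSymbolS11 d m b)
    (ψ F : 𝓢(RD d, ℂ)) (x : RD d) : Integrable fun y => ψ y * pdo b F (x - y) := by
  obtain ⟨B, hB⟩ := hb.norm_pdo_le F
  exact ψ.integrable.mul_bdd (c := B) ((hb.continuous_pdo F).comp
    (continuous_const.sub continuous_id)).aestronglyMeasurable (ae_of_all _ fun y => hB _)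

lemma IsSymbolS11.integral_dilateS_lineDeriv {m : ℝ} {b : RD d → RD d → ℂ}
    (hb : IsSymbolS11 d m b) (ψ F : 𝓢(RD d, ℂ)) (j : ℕ) (v x : RD d) :
    (((2 : ℝ) ^ j : ℝ) : ℂ) * ∫ y, dilateS j (∂_{v} ψ) y * pdo b F (x - y) =
      ∫ y, dilateS j ψ y * pdo (_root_.symbolDeriv b v) F (x - y) := by
  have h := integral_bilinear_hasLineDerivAt_right_eq_neg_left_of_integrable (μ := volume)
    (B := ContinuousLinearMap.mul ℝ ℂ) (v := v)
    (f := fun y => pdo b F (x - y)) (f' := fun y => -pdo (_root_.symbolDeriv b v) F (x - y))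
    (g := dilateS j ψ) (g' := fun y => (((2 : ℝ) ^ j : ℝ) : ℂ) * dilateS j (∂_{v} ψ) y)
    ?_ ?_ ?_ (fun y _ => ?_) (fun y _ => hasLineDerivAt_dilateS j ψ v y)
  · simp only [ContinuousLinearMap.mul_apply', neg_mul, integral_neg, neg_neg] at h
    rw [← integral_const_mul]
    refine Eq.trans (integral_congr_ae (ae_of_all _ fun y => ?_))
      (h.trans (integral_congr_ae (ae_of_all _ fun y => mul_comm _ _)))
    beta_reduce
    ring
  · convert ((hb.symbolDeriv v).integrable_mul_pdo (dilateS j ψ) F x).neg using 2 with y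
    simp [mul_comm]
  · convert (hb.integrable_mul_pdo (dilateS j (∂_{v} ψ)) F x).const_mul
      (((2 : ℝ) ^ j : ℝ) : ℂ) using 2 with y
    simp only [ContinuousLinearMap.mul_apply']
    ring
  · convert hb.integrable_mul_pdo (dilateS j ψ) F x using 2 with y
    simp [mul_comm]
  · have h1 := hb.hasLineDerivAt_pdo F (x - y) v
    rw [HasLineDerivAt] at h1 ⊢
    have h2 : HasDerivAt (fun t : ℝ => -t) (-1) 0 := (hasDerivAt_id (0 : ℝ)).neg
    have h3 := HasDerivAt.scomp (0 : ℝ) (h := fun t : ℝ => -t)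
      (g₁ := fun t : ℝ => pdo b F (x - y + t • v)) (by simpa using h1) h2
    convert h3 using 1
    · funext t
      simp only [Function.comp_apply]
      congr 1
      simp
      abel
    · simp

lemma IsSymbolS11.exists_enorm_mollify_gain {ψ : 𝓢(RD d, ℂ)}
    (hψ : ∀ ξ, fourierS ψ ξ ≠ 0 → 1 / 2 ≤ ‖ξ‖ ∧ ‖ξ‖ ≤ 2) {m : ℝ} {b : RD d → RD d → ℂ}
    (hb : IsSymbolS11 d m b) (D : LPData d) (N : ℝ) (M : ℕ) :
    ∃ C : ℝ≥0∞, C ≠ ⊤ ∧ ∀ j k, k ≤ j → ∀ f x,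
      ‖∫ y, dilateS j ψ y * pdo b (pieceS D k f) (x - y)‖ₑ ≤
        C * (2 : ℝ≥0∞) ^ ((k : ℝ) * m - ((j : ℝ) - k) * M) *
          wavg k N (fun y => ‖pieceS D k f y‖ₑ) x := by
  induction M generalizing ψ m b with
  | zero =>
    obtain ⟨C, hC, h⟩ := hb.exists_enorm_mollify_le D ψ N
    refine ⟨C, hC, fun j k hjk f x => ?_⟩
    simpa [min_eq_right hjk] using h j k f x
  | succ M ih =>
    obtain ⟨Ψ, hΨ, rfl⟩ := exists_primitives hψ
    choose C hC h using fun i => ih (hΨ i) (hb.symbolDeriv (EuclideanSpace.single i (1 : ℝ)))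
    refine ⟨∑ i, C i, by simpa using hC, fun j k hjk f x => ?_⟩
    have hsum : ∀ y, dilateS j (∑ i, ∂_{EuclideanSpace.single i (1 : ℝ)} (Ψ i)) y =
        ∑ i, dilateS j (∂_{EuclideanSpace.single i (1 : ℝ)} (Ψ i)) y := fun y => by
      simp only [dilateS_apply, _root_.sum_apply, Finset.mul_sum]
    simp only [hsum, Finset.sum_mul]
    rw [integral_finsetSum _ fun i _ => hb.integrable_mul_pdo _ _ _]
    refine (enorm_sum_le _ _).trans (Finset.sum_le_sum fun i _ => ?_)
    have h2 : (((2 : ℝ) ^ j : ℝ) : ℂ) ≠ 0 := by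
      rw [Complex.ofReal_ne_zero]
      positivity
    rw [← inv_mul_cancel_left₀ h2 (∫ y, dilateS j (∂_{EuclideanSpace.single i (1 : ℝ)} (Ψ i)) y *
      pdo b (pieceS D k f) (x - y)), hb.integral_dilateS_lineDeriv, enorm_mul]
    have h3 : ‖((((2 : ℝ) ^ j : ℝ) : ℂ))⁻¹‖ₑ = (2 : ℝ≥0∞) ^ (-(j : ℝ)) := by
      rw [← ofReal_norm, norm_inv, Complex.norm_real, Real.norm_of_nonneg (by positivity),
        ← ofReal_two_rpow, Real.rpow_neg (by norm_num), Real.rpow_natCast]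
    rw [h3]
    refine (mul_le_mul_right (h i j k hjk f x) _).trans_eq ?_
    have h4 : (k : ℝ) * m - ((j : ℝ) - k) * ((M + 1 : ℕ) : ℝ) =
        -(j : ℝ) + ((k : ℝ) * (m + 1) - ((j : ℝ) - k) * M) := by
      push_cast
      ring
    rw [h4, two_rpow_add]
    ring

end orthogonality

/-! ### Littlewood–Paley decomposition of `pdo a f` -/

section decomposition

variable {d : ℕ}

lemma exists_norm_LPhat_decay (D : LPData d) :
    ∃ C : ℝ, 0 ≤ C ∧ ∀ k ξ, ‖LPhat D k ξ‖ ≤ C * (1 / 2) ^ k * (1 + ‖ξ‖) := by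
  obtain ⟨C, hC0, hC⟩ := exists_norm_LPhat_le D
  refine ⟨2 * C, by positivity, fun k ξ => ?_⟩
  by_cases h : LPhat D k ξ = 0
  · rw [h, norm_zero]
    positivity
  refine (hC k ξ).trans ?_
  have h1 : (1 : ℝ) ≤ 2 * (1 / 2) ^ k * (1 + ‖ξ‖) := by
    cases k with
    | zero =>
      have := norm_nonneg ξ
      norm_num
      linarith
    | succ k =>
      have h2 := (LPhat_succ_support D k h).1
      have h3 : ((1 : ℝ) / 2) ^ (k + 1) * 2 ^ (k + 1) = 1 := by
        rw [← mul_pow]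
        norm_num
      have h4 : (0 : ℝ) < (1 / 2) ^ (k + 1) := by positivity
      nlinarith
  nlinarith

lemma IsSymbolS11.exists_norm_pdo_pieceS_decay {m : ℝ} {a : RD d → RD d → ℂ}
    (ha : IsSymbolS11 d m a) (D : LPData d) (f : 𝓢(RD d, ℂ)) :
    ∃ K : ℝ, 0 ≤ K ∧ ∀ k x, ∫ ξ, ‖pdoIntegrand a (pieceS D k f) x ξ‖ ≤ K * (1 / 2) ^ k := by
  obtain ⟨C, hC0, hC⟩ := exists_norm_LPhat_decay D
  obtain ⟨c, hc0, hc⟩ := ha.norm_pdoIntegrand_le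
  have hint := integrable_rpow_mul_schwartz (fourierS f) (m + 1)
  refine ⟨c * C * ∫ ξ, (1 + ‖ξ‖) ^ (m + 1) * ‖fourierS f ξ‖, ?_, fun k x => ?_⟩
  · have : 0 ≤ ∫ ξ, (1 + ‖ξ‖) ^ (m + 1) * ‖fourierS f ξ‖ :=
      integral_nonneg fun ξ => by positivity
    positivity
  · calc ∫ ξ, ‖pdoIntegrand a (pieceS D k f) x ξ‖
        ≤ ∫ ξ, c * C * (1 / 2) ^ k * ((1 + ‖ξ‖) ^ (m + 1) * ‖fourierS f ξ‖) := by
          refine integral_mono (ha.integrable_pdoIntegrand _ x).norm (hint.const_mul _) fun ξ => ?_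
          refine (hc _ x ξ).trans ?_
          have hp : (0 : ℝ) < 1 + ‖ξ‖ := by positivity
          rw [fourierS_pieceS, norm_mul, Real.rpow_add hp, Real.rpow_one]
          calc _ ≤ c * ((1 + ‖ξ‖) ^ m * (C * (1 / 2) ^ k * (1 + ‖ξ‖) * ‖fourierS f ξ‖)) := by
                gcongr
                exact hC k ξ
            _ = _ := by ring
      _ = _ := by
          rw [integral_const_mul]
          ring

lemma IsSymbolS11.hasSum_pdo_pieceS {m : ℝ} {a : RD d → RD d → ℂ}
    (ha : IsSymbolS11 d m a) (D : LPData d) (f : 𝓢(RD d, ℂ)) (x : RD d) :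
    HasSum (fun k => pdo a (pieceS D k f) x) (pdo a f x) := by
  obtain ⟨K, -, hK⟩ := ha.exists_norm_pdo_pieceS_decay D f
  have h := hasSum_integral_of_summable_integral_norm (μ := volume)
    (F := fun k => pdoIntegrand a (pieceS D k f) x)
    (fun k => ha.integrable_pdoIntegrand _ x)
    (Summable.of_nonneg_of_le (fun k => integral_nonneg fun ξ => norm_nonneg _)
      (fun k => hK k x) (summable_geometric_two.mul_left K))
  have heq : ∫ ξ, ∑' k, pdoIntegrand a (pieceS D k f) x ξ = pdo a f x := by
    refine integral_congr_ae (ae_of_all _ fun ξ => ?_)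
    have h1 := (hasSum_LPhat D ξ).mul_right (pdoIntegrand a f x ξ)
    rw [one_mul] at h1
    refine Eq.trans (tsum_congr fun k => ?_) h1.tsum_eq
    simp only [pdoIntegrand, fourierS_pieceS]
    ring
  rw [← heq]
  exact h

lemma IsSymbolS11.enorm_LP_pdo_le {m : ℝ} {a : RD d → RD d → ℂ}
    (ha : IsSymbolS11 d m a) (D : LPData d) (f : 𝓢(RD d, ℂ)) {j : ℕ} (hj : j ≠ 0) (x : RD d) :
    ‖LP D j (pdo a f) x‖ₑ ≤
      ∑' k, ‖∫ y, dilateS j D.φ y * pdo a (pieceS D k f) (x - y)‖ₑ := by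
  obtain ⟨K, hK0, hK⟩ := ha.exists_norm_pdo_pieceS_decay D f
  have hb : ∀ k z, ‖pdo a (pieceS D k f) z‖ ≤ K * (1 / 2) ^ k := fun k z =>
    (norm_integral_le_integral_norm _).trans (hK k z)
  set ψ := dilateS j D.φ with hψ
  have hint : Integrable fun y => ‖ψ y‖ := ψ.integrable.norm
  have h := hasSum_integral_of_summable_integral_norm (μ := volume)
    (F := fun k y => ψ y * pdo a (pieceS D k f) (x - y))
    (fun k => ha.integrable_mul_pdo ψ _ x)
    (Summable.of_nonneg_of_le (fun k => integral_nonneg fun ξ => norm_nonneg _)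
      (fun k => (integral_mono (ha.integrable_mul_pdo ψ _ x).norm
        (hint.mul_const (K * (1 / 2) ^ k)) fun y => by
          beta_reduce
          rw [norm_mul]
          gcongr
          exact hb k _).trans_eq (integral_mul_const _ _))
      ((summable_geometric_two.mul_left K).mul_left _))
  have hLP : LP D j (pdo a f) x = ∫ y, ∑' k, ψ y * pdo a (pieceS D k f) (x - y) := by
    obtain ⟨i, rfl⟩ := Nat.exists_eq_succ_of_ne_zero hj
    refine integral_congr_ae (ae_of_all _ fun y => ?_)
    exact ((ha.hasSum_pdo_pieceS D f (x - y)).mul_left (ψ y)).tsum_eq.symm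
  rw [hLP, ← h.tsum_eq]
  exact enorm_tsum_le_tsum_enorm

end decomposition

/-! ### Geometric sums -/

section geometric

/-- The geometric series `∑ 2^{-ri}`. -/
def geom (r : ℝ) : ℝ≥0∞ := ∑' i : ℕ, (2 : ℝ≥0∞) ^ (-((i : ℝ) * r))

lemma geom_ne_top {r : ℝ} (hr : 0 < r) : geom r ≠ ⊤ := by
  have h : ∀ i : ℕ, (2 : ℝ≥0∞) ^ (-((i : ℝ) * r)) = ((2 : ℝ≥0∞) ^ (-r)) ^ i := fun i => by
    rw [← ENNReal.rpow_natCast, ← ENNReal.rpow_mul]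
    ring_nf
  have h1 : (2 : ℝ≥0∞) ^ (-r) < 1 := by
    rw [← ENNReal.rpow_zero (x := (2 : ℝ≥0∞))]
    exact ENNReal.rpow_lt_rpow_of_exponent_lt ENNReal.one_lt_two ENNReal.ofNat_ne_top (by linarith)
  simp only [geom, h, ENNReal.tsum_geometric]
  exact ENNReal.inv_ne_top.2 (tsub_pos_of_lt h1).ne'

lemma tsum_two_sided_le (r : ℝ) (hr : 0 ≤ r) (j : ℕ) :
    ∑' k : ℕ, (2 : ℝ≥0∞) ^ (-(|(j : ℝ) - k| * r)) ≤ 2 * geom r := by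
  rw [← Summable.sum_add_tsum_nat_add' (k := j) ENNReal.summable, two_mul]
  refine add_le_add ?_ ?_
  · rw [← Finset.sum_range_reflect]
    refine (Finset.sum_le_sum fun i hi => ?_).trans (ENNReal.sum_le_tsum (Finset.range j))
    have hi' := Finset.mem_range.1 hi
    refine two_rpow_le ?_
    have : ((j - 1 - i : ℕ) : ℝ) = (j : ℝ) - 1 - i := by
      rw [Nat.sub_sub, Nat.cast_sub (by omega)]
      push_cast
      ring
    rw [this, abs_of_nonneg (by ring_nf; positivity)]
    nlinarith
  · refine ENNReal.tsum_le_tsum fun i => two_rpow_le ?_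
    rw [abs_sub_comm, abs_of_nonneg (by push_cast; linarith [Nat.cast_nonneg (α := ℝ) i])]
    push_cast
    linarith

lemma exists_tsum_rpow_le {q ε : ℝ} (hq : 0 < q) (hε : 0 < ε) : ∃ C : ℝ≥0∞, C ≠ ⊤ ∧
    ∀ (j : ℕ) (b : ℕ → ℝ≥0∞),
      (∑' k, b k) ^ q ≤ C * ∑' k : ℕ, (2 : ℝ≥0∞) ^ (|(j : ℝ) - k| * ε) * b k ^ q := by
  refine ⟨(2 * geom (ε / q)) ^ q, ENNReal.rpow_ne_top_of_nonneg hq.le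
    (ENNReal.mul_ne_top ENNReal.ofNat_ne_top (geom_ne_top (by positivity))), fun j b => ?_⟩
  set A := ∑' k : ℕ, (2 : ℝ≥0∞) ^ (|(j : ℝ) - k| * ε) * b k ^ q with hA
  have hb : ∀ k, b k ≤ (2 : ℝ≥0∞) ^ (-(|(j : ℝ) - k| * (ε / q))) * A ^ (1 / q) := fun k => by
    have h1 : (2 : ℝ≥0∞) ^ (|(j : ℝ) - k| * ε) * b k ^ q ≤ A := ENNReal.le_tsum k
    have h2 := ENNReal.rpow_le_rpow h1 (z := 1 / q) (by positivity)
    rw [ENNReal.mul_rpow_of_nonneg _ _ (by positivity), ← ENNReal.rpow_mul, ← ENNReal.rpow_mul,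
      mul_one_div_cancel hq.ne', ENNReal.rpow_one] at h2
    calc b k = (2 : ℝ≥0∞) ^ (-(|(j : ℝ) - k| * (ε / q))) *
          ((2 : ℝ≥0∞) ^ (|(j : ℝ) - k| * ε * (1 / q)) * b k) := by
          rw [← mul_assoc, ← two_rpow_add]
          have : -(|(j : ℝ) - k| * (ε / q)) + |(j : ℝ) - k| * ε * (1 / q) = 0 := by ring
          rw [this, ENNReal.rpow_zero, one_mul]
      _ ≤ _ := mul_le_mul_right h2 _
  calc (∑' k, b k) ^ q ≤ (2 * geom (ε / q) * A ^ (1 / q)) ^ q := by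
        gcongr
        refine (ENNReal.tsum_le_tsum hb).trans ?_
        rw [ENNReal.tsum_mul_right]
        gcongr
        exact tsum_two_sided_le _ (by positivity) j
    _ = _ := by
        rw [ENNReal.mul_rpow_of_nonneg _ _ hq.le, ← ENNReal.rpow_mul, one_div_mul_cancel hq.ne',
          ENNReal.rpow_one]

lemma add_rpow_le_two_rpow_mul {q : ℝ} (hq : 0 < q) (u v : ℝ≥0∞) :
    (u + v) ^ q ≤ (2 : ℝ≥0∞) ^ q * (u ^ q + v ^ q) := by
  have h : ∀ {u v : ℝ≥0∞}, u ≤ v → (u + v) ^ q ≤ (2 : ℝ≥0∞) ^ q * (u ^ q + v ^ q) := by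
    intro u v huv
    calc (u + v) ^ q ≤ (2 * v) ^ q := by
          gcongr
          rw [two_mul]
          gcongr
      _ = 2 ^ q * v ^ q := ENNReal.mul_rpow_of_nonneg _ _ hq.le
      _ ≤ _ := by
          gcongr
          exact le_add_self
  rcases le_total u v with huv | huv
  · exact h huv
  · rw [add_comm u, add_comm (u ^ q)]
    exact h huv

lemma sum_two_rpow_le (μ j : ℕ) :
    ∑ k ∈ Finset.range μ, (2 : ℝ≥0∞) ^ (-((j : ℝ) - k)) ≤ (2 : ℝ≥0∞) ^ (-((j : ℝ) - μ)) := by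
  induction μ with
  | zero => simp
  | succ μ ih =>
    rw [Finset.sum_range_succ]
    refine (add_le_add_left ih _).trans_eq ?_
    rw [← two_mul]
    have : -((j : ℝ) - ((μ + 1 : ℕ) : ℝ)) = 1 + -((j : ℝ) - μ) := by
      push_cast
      ring
    rw [this, two_rpow_add, ENNReal.rpow_one]

end geometric

/-! ### Summation -/

section summation

variable {d : ℕ}

/-- The modulus of the `j`-th Littlewood–Paley piece of `pdo a` applied to the `k`-th piece
of `f`. -/
def blockNorm (D : LPData d) (a : RD d → RD d → ℂ) (f : 𝓢(RD d, ℂ)) (j k : ℕ) (x : RD d) : ℝ≥0∞ :=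
  ‖∫ y, dilateS j D.φ y * pdo a (pieceS D k f) (x - y)‖ₑ

lemma IsSymbolS11.exists_sum_blockNorm_le {m : ℝ} {a : RD d → RD d → ℂ} (ha : IsSymbolS11 d m a)
    (D : LPData d) (s : ℝ) : ∃ C : ℝ≥0∞, C ≠ ⊤ ∧ ∀ (μ : ℕ) (f : 𝓢(RD d, ℂ)) (l : ℕ) (x : RD d),
      (2 : ℝ≥0∞) ^ (s * ((μ : ℝ) + l)) * ∑ k ∈ Finset.range μ, blockNorm D a f (μ + l) k x ≤
        C * (⨆ k ∈ Finset.range μ, (2 : ℝ≥0∞) ^ ((k : ℝ) * (s + m)) *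
          ⨆ x : RD d, (‖LP D k (⇑f) x‖₊ : ℝ≥0∞)) * (2 : ℝ≥0∞) ^ (-(l : ℝ)) := by
  obtain ⟨M, hM⟩ := exists_nat_ge (s + 1)
  obtain ⟨C, hC, h⟩ := ha.exists_enorm_mollify_gain D.supp_φ D (d + 1) M
  have hW : wtMass d (d + 1) ≠ ⊤ := wtMass_ne_top (by linarith)
  refine ⟨C * wtMass d (d + 1), ENNReal.mul_ne_top hC hW, fun μ f l x => ?_⟩
  set S := ⨆ k ∈ Finset.range μ, (2 : ℝ≥0∞) ^ ((k : ℝ) * (s + m)) *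
    ⨆ x : RD d, (‖LP D k (⇑f) x‖₊ : ℝ≥0∞) with hS
  have hterm : ∀ k ∈ Finset.range μ,
      (2 : ℝ≥0∞) ^ (s * ((μ : ℝ) + l)) * blockNorm D a f (μ + l) k x ≤
        C * wtMass d (d + 1) * S * (2 : ℝ≥0∞) ^ (-(((μ + l : ℕ) : ℝ) - k)) := by
    intro k hk
    have hkμ : k ≤ μ + l := by
      have := Finset.mem_range.1 hk
      omega
    set Sk := ⨆ x : RD d, (‖LP D k (⇑f) x‖₊ : ℝ≥0∞) with hSk
    have h1 : wavg k (d + 1) (fun y => ‖pieceS D k f y‖ₑ) x ≤ wtMass d (d + 1) * Sk :=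
      wavg_le_of_le _ _ (fun y => by
        rw [pieceS_apply]
        exact le_iSup (fun x : RD d => (‖LP D k (⇑f) x‖₊ : ℝ≥0∞)) y) x
    have h2 : (2 : ℝ≥0∞) ^ ((k : ℝ) * (s + m)) * Sk ≤ S :=
      le_iSup₂ (f := fun k (_ : k ∈ Finset.range μ) => (2 : ℝ≥0∞) ^ ((k : ℝ) * (s + m)) *
        ⨆ x : RD d, (‖LP D k (⇑f) x‖₊ : ℝ≥0∞)) k hk
    have hcast : (0 : ℝ) ≤ ((μ + l : ℕ) : ℝ) - k := by
      rw [sub_nonneg]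
      exact_mod_cast hkμ
    have h3 : (2 : ℝ≥0∞) ^ (s * ((μ : ℝ) + l)) *
        (2 : ℝ≥0∞) ^ ((k : ℝ) * m - (((μ + l : ℕ) : ℝ) - k) * M) ≤
        (2 : ℝ≥0∞) ^ ((k : ℝ) * (s + m)) * (2 : ℝ≥0∞) ^ (-(((μ + l : ℕ) : ℝ) - k)) := by
      rw [← two_rpow_add, ← two_rpow_add]
      refine two_rpow_le ?_
      push_cast at hcast ⊢
      nlinarith
    calc (2 : ℝ≥0∞) ^ (s * ((μ : ℝ) + l)) * blockNorm D a f (μ + l) k x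
        ≤ (2 : ℝ≥0∞) ^ (s * ((μ : ℝ) + l)) * (C * (2 : ℝ≥0∞) ^
            ((k : ℝ) * m - (((μ + l : ℕ) : ℝ) - k) * M) * (wtMass d (d + 1) * Sk)) :=
          mul_le_mul_right ((h (μ + l) k hkμ f x).trans (mul_le_mul_right h1 _)) _
      _ = C * wtMass d (d + 1) * Sk * ((2 : ℝ≥0∞) ^ (s * ((μ : ℝ) + l)) *
            (2 : ℝ≥0∞) ^ ((k : ℝ) * m - (((μ + l : ℕ) : ℝ) - k) * M)) := by ring
      _ ≤ C * wtMass d (d + 1) * Sk * ((2 : ℝ≥0∞) ^ ((k : ℝ) * (s + m)) *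
            (2 : ℝ≥0∞) ^ (-(((μ + l : ℕ) : ℝ) - k))) := mul_le_mul_right h3 _
      _ = C * wtMass d (d + 1) * ((2 : ℝ≥0∞) ^ ((k : ℝ) * (s + m)) * Sk) *
            (2 : ℝ≥0∞) ^ (-(((μ + l : ℕ) : ℝ) - k)) := by ring
      _ ≤ _ := mul_le_mul_left (mul_le_mul_right h2 _) _
  rw [Finset.mul_sum]
  refine (Finset.sum_le_sum hterm).trans ?_
  rw [← Finset.mul_sum]
  refine mul_le_mul_right ((sum_two_rpow_le μ (μ + l)).trans_eq ?_) _
  push_cast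
  ring_nf

lemma wavg_enorm_schwartz_ne_top {N : ℝ} (hN : (d : ℝ) < N) (F : 𝓢(RD d, ℂ)) (j : ℕ) (x : RD d) :
    wavg j N (fun y => ‖F y‖ₑ) x ≠ ⊤ := by
  refine ne_top_of_le_ne_top (ENNReal.mul_ne_top (wtMass_ne_top hN) ENNReal.ofReal_ne_top)
    (wavg_le_of_le (c := ENNReal.ofReal (SchwartzMap.seminorm ℝ 0 0 F)) j N (fun y => ?_) x)
  rw [← ofReal_norm]
  exact ENNReal.ofReal_le_ofReal (SchwartzMap.norm_le_seminorm ℝ F y)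

lemma exponent_gap_pos {q s : ℝ} (hq : 0 < q) (hs : s > (d : ℝ) / min 1 q - d) :
    0 < s * q - d * (1 - min 1 q) := by
  have hq' : 0 < min 1 q := lt_min one_pos hq
  have h1 : min 1 q ≤ 1 := min_le_left _ _
  have h2 : min 1 q ≤ q := min_le_right _ _
  have h3 : (d : ℝ) < (s + d) * min 1 q := by
    rw [← div_lt_iff₀ hq']
    linarith
  have hd : (0 : ℝ) ≤ d := Nat.cast_nonneg d
  have h4 : 0 < s := by
    by_contra! hs0
    nlinarith
  nlinarith

lemma IsSymbolS11.exists_blockNorm_rpow_le {m : ℝ} {a : RD d → RD d → ℂ} (ha : IsSymbolS11 d m a)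
    (D : LPData d) {q s : ℝ} (hq : 0 < q) (hs : s > (d : ℝ) / min 1 q - d) :
    ∃ (C : ℝ≥0∞) (δ : ℝ), C ≠ ⊤ ∧ 0 < δ ∧ ∀ (f : 𝓢(RD d, ℂ)) (j k : ℕ) (x : RD d),
      ((2 : ℝ≥0∞) ^ (s * j) * blockNorm D a f j k x) ^ q ≤
        C * (2 : ℝ≥0∞) ^ (-(|(j : ℝ) - k| * δ)) * ((2 : ℝ≥0∞) ^ ((s + m) * k * q) *
          wavg (min j k) (((d : ℝ) + 1) + ((d : ℝ) + 1)) (fun y => ‖pieceS D k f y‖ₑ ^ q) x) := by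
  have hq' : 0 < min 1 q := lt_min one_pos hq
  set N : ℝ := (((d : ℝ) + 1) + ((d : ℝ) + 1)) / min 1 q with hN
  have hNq : N * min 1 q = ((d : ℝ) + 1) + ((d : ℝ) + 1) := div_mul_cancel₀ _ hq'.ne'
  have hdN : (d : ℝ) < N := by
    rw [hN, lt_div_iff₀ hq']
    have : (0 : ℝ) ≤ d := Nat.cast_nonneg d
    nlinarith [min_le_left 1 q]
  obtain ⟨M, hM⟩ := exists_nat_ge (s + 1)
  obtain ⟨C₀, hC₀, h₀⟩ := exists_enorm_pieceS_le D N
  obtain ⟨Cw, hCw, hw⟩ := wavg_rpow_le hdN hq hC₀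
  obtain ⟨C₁, hC₁, h₁⟩ := ha.exists_enorm_mollify_le D D.φ N
  obtain ⟨C₂, hC₂, h₂⟩ := ha.exists_enorm_mollify_gain D.supp_φ D N M
  have hgap := exponent_gap_pos hq hs
  set δ := min ((M - s) * q) (s * q - d * (1 - min 1 q)) with hδ
  refine ⟨(C₁ + C₂) ^ q * Cw, δ, ENNReal.mul_ne_top (ENNReal.rpow_ne_top_of_nonneg hq.le
    (ENNReal.add_ne_top.2 ⟨hC₁, hC₂⟩)) hCw, lt_min (mul_pos (by linarith) hq) hgap,
    fun f j k x => ?_⟩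
  have hm : Measurable fun y => ‖pieceS D k f y‖ₑ := (pieceS D k f).continuous.enorm.measurable
  have hw' := hw (min_le_right j k) hm (h₀ k f) x
    (wavg_enorm_schwartz_ne_top hdN (pieceS D k f) (min j k) x)
  rw [hNq] at hw'
  set W := wavg (min j k) N (fun y => ‖pieceS D k f y‖ₑ) x with hW
  set A := wavg (min j k) (((d : ℝ) + 1) + ((d : ℝ) + 1)) (fun y => ‖pieceS D k f y‖ₑ ^ q) x
    with hA
  have key : ∀ e : ℝ, blockNorm D a f j k x ≤ (C₁ + C₂) * (2 : ℝ≥0∞) ^ e * W →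
      s * j * q + e * q + (((k : ℝ) - (min j k : ℕ)) * d * (1 - min 1 q)) ≤
        -(|(j : ℝ) - k| * δ) + (s + m) * k * q →
      ((2 : ℝ≥0∞) ^ (s * j) * blockNorm D a f j k x) ^ q ≤
        (C₁ + C₂) ^ q * Cw * (2 : ℝ≥0∞) ^ (-(|(j : ℝ) - k| * δ)) *
          ((2 : ℝ≥0∞) ^ ((s + m) * k * q) * A) := by
    intro e he hexp
    calc ((2 : ℝ≥0∞) ^ (s * j) * blockNorm D a f j k x) ^ q
        ≤ ((2 : ℝ≥0∞) ^ (s * j) * ((C₁ + C₂) * (2 : ℝ≥0∞) ^ e * W)) ^ q :=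
          ENNReal.rpow_le_rpow (mul_le_mul_right he _) hq.le
      _ = (C₁ + C₂) ^ q * ((2 : ℝ≥0∞) ^ (s * j * q) * (2 : ℝ≥0∞) ^ (e * q)) * W ^ q := by
          rw [ENNReal.mul_rpow_of_nonneg _ _ hq.le, ENNReal.mul_rpow_of_nonneg _ _ hq.le,
            ENNReal.mul_rpow_of_nonneg _ _ hq.le, ← ENNReal.rpow_mul, ← ENNReal.rpow_mul]
          ring
      _ ≤ (C₁ + C₂) ^ q * ((2 : ℝ≥0∞) ^ (s * j * q) * (2 : ℝ≥0∞) ^ (e * q)) *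
            (Cw * (2 : ℝ≥0∞) ^ (((k : ℝ) - (min j k : ℕ)) * d * (1 - min 1 q)) * A) :=
          mul_le_mul_right hw' _
      _ = (C₁ + C₂) ^ q * Cw * A * (2 : ℝ≥0∞) ^
            (s * j * q + e * q + (((k : ℝ) - (min j k : ℕ)) * d * (1 - min 1 q))) := by
          rw [two_rpow_add, two_rpow_add]
          ring
      _ ≤ (C₁ + C₂) ^ q * Cw * A *
            (2 : ℝ≥0∞) ^ (-(|(j : ℝ) - k| * δ) + (s + m) * k * q) :=
          mul_le_mul_right (two_rpow_le hexp) _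
      _ = _ := by
          rw [two_rpow_add]
          ring
  rcases le_total k j with hkj | hjk
  · have hkj' : (k : ℝ) ≤ j := by exact_mod_cast hkj
    refine key ((k : ℝ) * m - ((j : ℝ) - k) * M) ?_ ?_
    · have := h₂ j k hkj f x
      rw [← min_eq_right hkj] at this
      simp only [min_eq_right hkj] at this
      rw [hW, min_eq_right hkj]
      refine this.trans (mul_le_mul_left (mul_le_mul_left le_add_self _) _)
    · rw [min_eq_right hkj, abs_of_nonneg (by linarith), sub_self, zero_mul, zero_mul, add_zero]
      have h3 : δ ≤ (M - s) * q := min_le_left _ _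
      nlinarith [mul_le_mul_of_nonneg_left h3 (sub_nonneg.2 hkj')]
  · have hjk' : (j : ℝ) ≤ k := by exact_mod_cast hjk
    refine key ((k : ℝ) * m) ?_ ?_
    · exact (h₁ j k f x).trans (mul_le_mul_left (mul_le_mul_left le_self_add _) _)
    · rw [min_eq_left hjk, abs_of_nonpos (by linarith)]
      have h3 : δ ≤ s * q - d * (1 - min 1 q) := min_le_right _ _
      nlinarith [mul_le_mul_of_nonneg_left h3 (sub_nonneg.2 hjk')]

lemma exists_mem_dyadicCube (μ : ℕ) (n : Fin d → ℤ) : ∃ z, z ∈ dyadicCube d μ n := by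
  refine ⟨WithLp.toLp 2 fun i => (n i : ℝ) * (2 : ℝ) ^ (-(μ : ℤ)), fun i => ⟨le_rfl, ?_⟩⟩
  have : (0 : ℝ) < (2 : ℝ) ^ (-(μ : ℤ)) := by positivity
  change (n i : ℝ) * (2 : ℝ) ^ (-(μ : ℤ)) < _
  nlinarith

lemma IsSymbolS11.exists_setLIntegral_tsum_le {m : ℝ} {a : RD d → RD d → ℂ}
    (ha : IsSymbolS11 d m a) (D : LPData d) {q s : ℝ} (hq : 0 < q)
    (hs : s > (d : ℝ) / min 1 q - d) :
    ∃ C : ℝ≥0∞, C ≠ ⊤ ∧ ∀ (μ : ℕ) (f : 𝓢(RD d, ℂ)) (n : Fin d → ℤ),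
      ∫⁻ x in dyadicCube d μ n, ∑' l : ℕ, ((2 : ℝ≥0∞) ^ (s * ((μ : ℝ) + l)) *
          ∑' i : ℕ, blockNorm D a f (μ + l) (μ + i) x) ^ q ≤
        C * ⨆ n' : Fin d → ℤ, ∫⁻ x in dyadicCube d μ n', ∑' i : ℕ,
          (2 : ℝ≥0∞) ^ ((s + m) * ((μ : ℝ) + i) * q) * (‖LP D (μ + i) (⇑f) x‖₊ : ℝ≥0∞) ^ q := by
  obtain ⟨C₁, δ, hC₁, hδ, h₁⟩ := ha.exists_blockNorm_rpow_le D hq hs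
  obtain ⟨C₂, hC₂, h₂⟩ := exists_tsum_rpow_le hq (half_pos hδ)
  set L : ℝ := (d : ℝ) + 1 with hL
  have hL0 : 0 ≤ L := by positivity
  have hdL : (d : ℝ) < L := by linarith
  set K := ENNReal.ofReal (1 + d) ^ L * wtMass d L with hK
  have hKt : K ≠ ⊤ := ENNReal.mul_ne_top
    (ENNReal.rpow_ne_top_of_nonneg hL0 ENNReal.ofReal_ne_top) (wtMass_ne_top hdL)
  have hG : (2 * geom (δ / 2)) ≠ ⊤ :=
    ENNReal.mul_ne_top ENNReal.ofNat_ne_top (geom_ne_top (half_pos hδ))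
  refine ⟨C₂ * C₁ * (2 * geom (δ / 2)) * K * K, by finiteness, fun μ f n => ?_⟩
  obtain ⟨z, hz⟩ := exists_mem_dyadicCube μ n
  set w : ℕ → ℝ≥0∞ := fun i => (2 : ℝ≥0∞) ^ ((s + m) * ((μ : ℝ) + i) * q) with hw
  set h : ℕ → RD d → ℝ≥0∞ := fun i y => ‖pieceS D (μ + i) f y‖ₑ ^ q with hh
  have hm : ∀ i, Measurable (h i) := fun i =>
    (pieceS D (μ + i) f).continuous.enorm.measurable.pow_const q
  have hpt : ∀ (l : ℕ) x, ((2 : ℝ≥0∞) ^ (s * ((μ : ℝ) + l)) *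
      ∑' i : ℕ, blockNorm D a f (μ + l) (μ + i) x) ^ q ≤
      ∑' i : ℕ, C₂ * C₁ * (2 : ℝ≥0∞) ^ (-(|(l : ℝ) - i| * (δ / 2))) *
        (w i * wavg (min (μ + l) (μ + i)) (L + L) (h i) x) := by
    intro l x
    rw [← ENNReal.tsum_mul_left]
    refine (h₂ l _).trans ?_
    rw [← ENNReal.tsum_mul_left]
    refine ENNReal.tsum_le_tsum fun i => ?_
    have h3 := h₁ f (μ + l) (μ + i) x
    have h4 : |((μ + l : ℕ) : ℝ) - (μ + i : ℕ)| = |(l : ℝ) - i| := by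
      push_cast
      ring_nf
    rw [h4] at h3
    push_cast at h3
    calc C₂ * ((2 : ℝ≥0∞) ^ (|(l : ℝ) - i| * (δ / 2)) * ((2 : ℝ≥0∞) ^ (s * ((μ : ℝ) + l)) *
          blockNorm D a f (μ + l) (μ + i) x) ^ q)
        ≤ C₂ * ((2 : ℝ≥0∞) ^ (|(l : ℝ) - i| * (δ / 2)) *
          (C₁ * (2 : ℝ≥0∞) ^ (-(|(l : ℝ) - i| * δ)) *
            (w i * wavg (min (μ + l) (μ + i)) (L + L) (h i) x))) :=
          mul_le_mul_right (mul_le_mul_right h3 _) _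
      _ = C₂ * C₁ * ((2 : ℝ≥0∞) ^ (|(l : ℝ) - i| * (δ / 2)) *
            (2 : ℝ≥0∞) ^ (-(|(l : ℝ) - i| * δ))) *
            (w i * wavg (min (μ + l) (μ + i)) (L + L) (h i) x) := by ring
      _ = _ := by
          rw [← two_rpow_add]
          congr 3
          ring
  set I : ℕ → ℝ≥0∞ := fun i => ∫⁻ y, wt μ L (z - y) * h i y with hI
  have hmw : ∀ l i : ℕ, Measurable fun x => C₂ * C₁ * (2 : ℝ≥0∞) ^ (-(|(l : ℝ) - i| * (δ / 2))) *
      (w i * wavg (min (μ + l) (μ + i)) (L + L) (h i) x) := fun l i =>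
    ((measurable_wavg _ _ (hm i)).const_mul _).const_mul _
  calc ∫⁻ x in dyadicCube d μ n, ∑' l : ℕ, ((2 : ℝ≥0∞) ^ (s * ((μ : ℝ) + l)) *
          ∑' i : ℕ, blockNorm D a f (μ + l) (μ + i) x) ^ q
      ≤ ∫⁻ x in dyadicCube d μ n, ∑' l : ℕ, ∑' i : ℕ,
          C₂ * C₁ * (2 : ℝ≥0∞) ^ (-(|(l : ℝ) - i| * (δ / 2))) *
            (w i * wavg (min (μ + l) (μ + i)) (L + L) (h i) x) :=
        lintegral_mono fun x => ENNReal.tsum_le_tsum fun l => hpt l x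
    _ = ∑' l : ℕ, ∑' i : ℕ, C₂ * C₁ * (2 : ℝ≥0∞) ^ (-(|(l : ℝ) - i| * (δ / 2))) *
          (w i * ∫⁻ x in dyadicCube d μ n, wavg (min (μ + l) (μ + i)) (L + L) (h i) x) := by
        rw [lintegral_tsum fun l => (Measurable.tsum fun i => hmw l i).aemeasurable]
        refine tsum_congr fun l => ?_
        rw [lintegral_tsum fun i => (hmw l i).aemeasurable]
        refine tsum_congr fun i => ?_
        rw [lintegral_const_mul _ ((measurable_wavg _ _ (hm i)).const_mul _),
          lintegral_const_mul _ (measurable_wavg _ _ (hm i))]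
    _ ≤ ∑' l : ℕ, ∑' i : ℕ, (2 : ℝ≥0∞) ^ (-(|(i : ℝ) - l| * (δ / 2))) *
          (C₂ * C₁ * (w i * (K * I i))) := by
        refine ENNReal.tsum_le_tsum fun l => ENNReal.tsum_le_tsum fun i => ?_
        rw [abs_sub_comm, mul_comm (C₂ * C₁), mul_assoc]
        refine mul_le_mul_right (mul_le_mul_right (mul_le_mul_right ?_ _) _) _
        exact setLIntegral_wavg_le (by omega) hL0 n (hm i) hz
    _ = ∑' i : ℕ, (∑' l : ℕ, (2 : ℝ≥0∞) ^ (-(|(i : ℝ) - l| * (δ / 2)))) *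
          (C₂ * C₁ * (w i * (K * I i))) := by
        rw [ENNReal.tsum_comm]
        exact tsum_congr fun i => ENNReal.tsum_mul_right
    _ ≤ ∑' i : ℕ, (2 * geom (δ / 2)) * (C₂ * C₁ * (w i * (K * I i))) :=
        ENNReal.tsum_le_tsum fun i => mul_le_mul_left
          (tsum_two_sided_le _ (half_pos hδ).le i) _
    _ = C₂ * C₁ * (2 * geom (δ / 2)) * K * ∑' i : ℕ, w i * I i := by
        rw [← ENNReal.tsum_mul_left]
        exact tsum_congr fun i => by ring
    _ = C₂ * C₁ * (2 * geom (δ / 2)) * K * ∫⁻ y, wt μ L (z - y) * ∑' i : ℕ, w i * h i y := by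
        congr 1
        have hmz : Measurable fun y : RD d => wt μ L (z - y) := by fun_prop
        simp only [← ENNReal.tsum_mul_left]
        have hmi : ∀ i, Measurable fun y : RD d => wt μ L (z - y) * (w i * h i y) :=
          fun i => hmz.mul ((hm i).const_mul _)
        have hmh : ∀ i, Measurable fun y : RD d => wt μ L (z - y) * h i y :=
          fun i => hmz.mul (hm i)
        rw [lintegral_tsum fun i => (hmi i).aemeasurable]
        refine tsum_congr fun i => ?_
        rw [hI, ← lintegral_const_mul _ (hmh i)]
        exact lintegral_congr fun y => by ring
    _ ≤ C₂ * C₁ * (2 * geom (δ / 2)) * K * (K * ⨆ n' : Fin d → ℤ,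
          ∫⁻ y in dyadicCube d μ n', ∑' i : ℕ, w i * h i y) :=
        mul_le_mul_right (lintegral_wt_mul_le_iSup μ hdL _ z) _
    _ = _ := by
        rw [← mul_assoc]
        simp only [hh, hw, pieceS_apply]
        rfl

end summation

/-- for `a ∈ S^m_{1,1}` and `s > τ_q = d/min(1,q) - d`, the local
Triebel–Lizorkin quantity of `T_a f` over any dyadic cube of level `μ` is bounded,
uniformly in `μ` and `f`, by the corresponding quantities of `f`. -/
theorem statement0 (d : ℕ) (hd : 1 ≤ d) (m : ℝ) (q : ℝ) (hq : 0 < q)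
    (s : ℝ) (hs : s > (d : ℝ) / min 1 q - d)
    (D : LPData d) (a : RD d → RD d → ℂ) (ha : IsSymbolS11 d m a) :
    ∃ C : ℝ≥0, ∀ (μ : ℕ), 1 ≤ μ → ∀ (f : 𝓢(RD d, ℂ)) (n : Fin d → ℤ),
      cubePiece d μ n μ s q (fun k x => LP D k (pdo a f) x) ≤
        (C : ℝ≥0∞) *
          ((⨆ k ∈ Finset.range μ,
              (2:ℝ≥0∞)^((k:ℝ)*(s+m)) * ⨆ x : RD d, (‖LP D k (⇑f) x‖₊ : ℝ≥0∞)) +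
            ⨆ n' : Fin d → ℤ, cubePiece d μ n' μ (s+m) q (fun k x => LP D k (⇑f) x)) := by
  obtain ⟨C₁, hC₁, h₁⟩ := ha.exists_sum_blockNorm_le D s
  obtain ⟨C₂, hC₂, h₂⟩ := ha.exists_setLIntegral_tsum_le D hq hs
  set E := (2 : ℝ≥0∞) ^ q * (C₁ ^ q * geom q + C₂) with hE
  have hEt : E ≠ ⊤ := by
    refine ENNReal.mul_ne_top (two_rpow_ne_top q) (ENNReal.add_ne_top.2 ⟨ENNReal.mul_ne_top
      (ENNReal.rpow_ne_top_of_nonneg hq.le hC₁) (geom_ne_top hq), hC₂⟩)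
  have hE' : E ^ (1 / q) ≠ ⊤ := ENNReal.rpow_ne_top_of_nonneg (by positivity) hEt
  refine ⟨(E ^ (1 / q)).toNNReal, fun μ hμ f n => ?_⟩
  rw [ENNReal.coe_toNNReal hE']
  set S := ⨆ k ∈ Finset.range μ, (2 : ℝ≥0∞) ^ ((k : ℝ) * (s + m)) *
    ⨆ x : RD d, (‖LP D k (⇑f) x‖₊ : ℝ≥0∞) with hS
  set Y := ⨆ n' : Fin d → ℤ, cubePiece d μ n' μ (s + m) q (fun k x => LP D k (⇑f) x) with hY
  set J := ⨆ n' : Fin d → ℤ, ∫⁻ x in dyadicCube d μ n', ∑' i : ℕ,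
    (2 : ℝ≥0∞) ^ ((s + m) * ((μ : ℝ) + i) * q) * (‖LP D (μ + i) (⇑f) x‖₊ : ℝ≥0∞) ^ q with hJ
  have hJY : (2 : ℝ≥0∞) ^ ((μ : ℝ) * d) * J ≤ Y ^ q := by
    rw [hJ, ENNReal.mul_iSup]
    refine iSup_le fun n' => ?_
    have h3 : cubePiece d μ n' μ (s + m) q (fun k x => LP D k (⇑f) x) ≤ Y :=
      le_iSup (fun n' => cubePiece d μ n' μ (s + m) q (fun k x => LP D k (⇑f) x)) n'
    have h4 := ENNReal.rpow_le_rpow h3 hq.le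
    rwa [cubePiece, ← ENNReal.rpow_mul, one_div_mul_cancel hq.ne', ENNReal.rpow_one] at h4
  have hpt : ∀ (l : ℕ) x, (2 : ℝ≥0∞) ^ (s * ((μ : ℝ) + l) * q) *
      (‖LP D (μ + l) (pdo a f) x‖₊ : ℝ≥0∞) ^ q ≤
      (2 : ℝ≥0∞) ^ q * (C₁ * S) ^ q * (2 : ℝ≥0∞) ^ (-((l : ℝ) * q)) +
        (2 : ℝ≥0∞) ^ q * ((2 : ℝ≥0∞) ^ (s * ((μ : ℝ) + l)) *
          ∑' i : ℕ, blockNorm D a f (μ + l) (μ + i) x) ^ q := by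
    intro l x
    have h3 : (‖LP D (μ + l) (pdo a f) x‖₊ : ℝ≥0∞) ≤
        ∑ k ∈ Finset.range μ, blockNorm D a f (μ + l) k x +
          ∑' i : ℕ, blockNorm D a f (μ + l) (μ + i) x := by
      refine (ha.enorm_LP_pdo_le D f (j := μ + l) (by omega) x).trans_eq ?_
      rw [← Summable.sum_add_tsum_nat_add' (k := μ) ENNReal.summable]
      simp only [add_comm _ μ]
      rfl
    calc (2 : ℝ≥0∞) ^ (s * ((μ : ℝ) + l) * q) * (‖LP D (μ + l) (pdo a f) x‖₊ : ℝ≥0∞) ^ q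
        = ((2 : ℝ≥0∞) ^ (s * ((μ : ℝ) + l)) * (‖LP D (μ + l) (pdo a f) x‖₊ : ℝ≥0∞)) ^ q := by
          rw [ENNReal.mul_rpow_of_nonneg _ _ hq.le, ← ENNReal.rpow_mul]
      _ ≤ (C₁ * S * (2 : ℝ≥0∞) ^ (-(l : ℝ)) + (2 : ℝ≥0∞) ^ (s * ((μ : ℝ) + l)) *
            ∑' i : ℕ, blockNorm D a f (μ + l) (μ + i) x) ^ q := by
          refine ENNReal.rpow_le_rpow ((mul_le_mul_right h3 _).trans ?_) hq.le
          rw [mul_add]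
          exact add_le_add_left (h₁ μ f l x) _
      _ ≤ _ := by
          refine (add_rpow_le_two_rpow_mul hq _ _).trans_eq ?_
          rw [mul_add, ENNReal.mul_rpow_of_nonneg _ _ hq.le, ← ENNReal.rpow_mul, neg_mul,
            mul_assoc]
  have hmain : (2 : ℝ≥0∞) ^ ((μ : ℝ) * d) * ∫⁻ x in dyadicCube d μ n, ∑' l : ℕ,
      (2 : ℝ≥0∞) ^ (s * ((μ : ℝ) + l) * q) * (‖LP D (μ + l) (pdo a f) x‖₊ : ℝ≥0∞) ^ q ≤
      E * (S + Y) ^ q := by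
    calc (2 : ℝ≥0∞) ^ ((μ : ℝ) * d) * ∫⁻ x in dyadicCube d μ n, ∑' l : ℕ,
          (2 : ℝ≥0∞) ^ (s * ((μ : ℝ) + l) * q) * (‖LP D (μ + l) (pdo a f) x‖₊ : ℝ≥0∞) ^ q
        ≤ (2 : ℝ≥0∞) ^ ((μ : ℝ) * d) * ∫⁻ x in dyadicCube d μ n,
            ((2 : ℝ≥0∞) ^ q * (C₁ * S) ^ q * geom q +
              (2 : ℝ≥0∞) ^ q * ∑' l : ℕ, ((2 : ℝ≥0∞) ^ (s * ((μ : ℝ) + l)) *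
                ∑' i : ℕ, blockNorm D a f (μ + l) (μ + i) x) ^ q) := by
          refine mul_le_mul_right (lintegral_mono fun x => ?_) _
          refine (ENNReal.tsum_le_tsum fun l => hpt l x).trans_eq ?_
          rw [ENNReal.tsum_add, ENNReal.tsum_mul_left, ENNReal.tsum_mul_left]
          rfl
      _ = (2 : ℝ≥0∞) ^ ((μ : ℝ) * d) * ((2 : ℝ≥0∞) ^ q * (C₁ * S) ^ q * geom q *
            (2 : ℝ≥0∞) ^ (-((μ : ℝ) * d)) +
              (2 : ℝ≥0∞) ^ q * ∫⁻ x in dyadicCube d μ n,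
                ∑' l : ℕ, ((2 : ℝ≥0∞) ^ (s * ((μ : ℝ) + l)) *
                  ∑' i : ℕ, blockNorm D a f (μ + l) (μ + i) x) ^ q) := by
          rw [lintegral_add_left measurable_const, lintegral_const_mul' _ _ (two_rpow_ne_top q),
            setLIntegral_const, volume_dyadicCube]
      _ ≤ (2 : ℝ≥0∞) ^ ((μ : ℝ) * d) * ((2 : ℝ≥0∞) ^ q * (C₁ * S) ^ q * geom q *
            (2 : ℝ≥0∞) ^ (-((μ : ℝ) * d)) + (2 : ℝ≥0∞) ^ q * (C₂ * J)) :=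
          mul_le_mul_right (add_le_add_right (mul_le_mul_right (h₂ μ f n) _) _) _
      _ = (2 : ℝ≥0∞) ^ q * (C₁ ^ q * geom q * S ^ q *
            ((2 : ℝ≥0∞) ^ ((μ : ℝ) * d) * (2 : ℝ≥0∞) ^ (-((μ : ℝ) * d))) +
              C₂ * ((2 : ℝ≥0∞) ^ ((μ : ℝ) * d) * J)) := by
          rw [ENNReal.mul_rpow_of_nonneg _ _ hq.le]
          ring
      _ ≤ (2 : ℝ≥0∞) ^ q * (C₁ ^ q * geom q * (S + Y) ^ q + C₂ * (S + Y) ^ q) := by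
          rw [← two_rpow_add, add_neg_cancel, ENNReal.rpow_zero, mul_one]
          refine mul_le_mul_right (add_le_add (mul_le_mul_right ?_ _) (mul_le_mul_right ?_ _)) _
          · exact ENNReal.rpow_le_rpow le_self_add hq.le
          · exact hJY.trans (ENNReal.rpow_le_rpow le_add_self hq.le)
      _ = _ := by
          rw [hE]
          ring
  calc cubePiece d μ n μ s q (fun k x => LP D k (pdo a f) x)
      ≤ (E * (S + Y) ^ q) ^ (1 / q) := ENNReal.rpow_le_rpow hmain (by positivity)
    _ = _ := by
        rw [ENNReal.mul_rpow_of_nonneg _ _ (by positivity), ← ENNReal.rpow_mul,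
          mul_one_div_cancel hq.ne', ENNReal.rpow_one]

end
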